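/- arXiv:2011.13750 — 10 statements merged into one kernel-verified Lean document; each statement's English description precedes it below -/
import Mathlib

section
/- Let s ≥ 1 and n be integers with 2^s < n ≤ 2^{s+1} and n ≥ 4. Then the product w_1^{2^s} · w_2^{n−2^s−1} is a nonzero element of A(2,n) (of degree 2(n−2)−2^s+2). -/
open MvPolynomial TensorProduct

noncomputable section

/-- Weights for the grading: the variable `Sum.inl i` corresponds to the Stiefel-Whitney
class `w_{i+1}` (degree `i+1`), and `Sum.inr j` to the dual class `w̄_{j+1}` (degree `j+1`). -/
def grassWt (k m : ℕ) : Fin k ⊕ Fin m → ℕ :=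
  Sum.elim (fun i => (i : ℕ) + 1) (fun j => (j : ℕ) + 1)

/-- The relation `(1 + w_1 + ⋯ + w_k)·(1 + w̄_1 + ⋯ + w̄_m) - 1`. -/
def grassRel (k m : ℕ) : MvPolynomial (Fin k ⊕ Fin m) (ZMod 2) :=
  (1 + ∑ i : Fin k, X (Sum.inl i)) * (1 + ∑ j : Fin m, X (Sum.inr j)) - 1

/-- The ideal generated by the positive-degree weighted-homogeneous components of the relation. -/
def grassIdeal (k m : ℕ) : Ideal (MvPolynomial (Fin k ⊕ Fin m) (ZMod 2)) :=
  Ideal.span { p | ∃ d : ℕ, 0 < d ∧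
    p = weightedHomogeneousComponent (grassWt k m) d (grassRel k m) }

/-- `GrassCoh k m` is the ring `A(k, n)` with `m = n - k`, i.e. the mod 2 cohomology ring
of the Grassmannian `G_k(ℝ^{k+m})`. -/
abbrev GrassCoh (k m : ℕ) : Type :=
  MvPolynomial (Fin k ⊕ Fin m) (ZMod 2) ⧸ grassIdeal k m

/-- The Stiefel-Whitney class `w_{i+1}` in `A(k, k+m)`. -/
def sw (k m : ℕ) (i : Fin k) : GrassCoh k m :=
  Ideal.Quotient.mk (grassIdeal k m) (X (Sum.inl i))

/-- The polynomial ring in the two Chern-root-like variables. -/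
abbrev RootRing : Type := MvPolynomial (Fin 2) (ZMod 2)

/-- Complete homogeneous symmetric polynomial of degree `j` in two variables. -/
def hsym (j : ℕ) : RootRing :=
  ∑ i ∈ Finset.range (j + 1), X 0 ^ i * X 1 ^ (j + 1 - 1 - i)

lemma hsym_mul (j : ℕ) : hsym j * (X 0 - X 1) = X 0 ^ (j + 1) - X 1 ^ (j + 1) :=
  geom_sum₂_mul _ _ _

/-- Images of the generators. -/
def rootVal (m : ℕ) : Fin 2 ⊕ Fin m → RootRing :=
  Sum.elim ![X 0 + X 1, X 0 * X 1] (fun j => hsym (j + 1))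

/-- The map to the root ring. -/
def rootMap (m : ℕ) : MvPolynomial (Fin 2 ⊕ Fin m) (ZMod 2) →ₐ[ZMod 2] RootRing :=
  aeval (rootVal m)

lemma homX (i : Fin 2) : IsWeightedHomogeneous (fun _ : Fin 2 => 1) (X i : RootRing) 1 :=
  isWeightedHomogeneous_X _ _ _

lemma rootVal_hom (m : ℕ) (i : Fin 2 ⊕ Fin m) :
    IsWeightedHomogeneous (fun _ : Fin 2 => 1) (rootVal m i) (grassWt 2 m i) := by
  rcases i with i | j
  · fin_cases i
    · exact (homX 0).add (homX 1)
    · exact (homX 0).mul (homX 1)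
  · simp only [rootVal, grassWt, Sum.elim_inr, hsym]
    refine IsWeightedHomogeneous.sum _ _ _ ?_
    intro i hi
    have := ((homX 0).pow i).mul ((homX 1).pow ((j : ℕ) + 1 + 1 - 1 - i))
    simp only [Finset.mem_range] at hi
    convert this using 1
    simp only [smul_eq_mul]
    omega

lemma rootMap_comp (m d : ℕ) (q : MvPolynomial (Fin 2 ⊕ Fin m) (ZMod 2)) :
    rootMap m (weightedHomogeneousComponent (grassWt 2 m) d q) * (X 0 - X 1) =
      weightedHomogeneousComponent (fun _ : Fin 2 => 1) (d + 1) (rootMap m q * (X 0 - X 1)) := by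
  induction q using MvPolynomial.induction_on' with
  | add p q hp hq => simp only [map_add, add_mul, hp, hq]
  | monomial u a =>
    have e1 : IsWeightedHomogeneous (fun _ : Fin 2 => 1) (rootMap m (monomial u a))
        (Finsupp.weight (grassWt 2 m) u) := by
      rw [rootMap, aeval_monomial]
      have h := IsWeightedHomogeneous.prod u.support (fun i => rootVal m i ^ u i)
        (fun i => u i • grassWt 2 m i) (w := fun _ : Fin 2 => 1)
        (fun i _ => (rootVal_hom m i).pow (u i))
      exact h.C_mul a
    have e2 := e1.mul ((homX 0).sub (homX 1))
    rw [weightedHomogeneousComponent_of_mem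
        (show _ ∈ weightedHomogeneousSubmodule (ZMod 2) (grassWt 2 m) _ from
          isWeightedHomogeneous_monomial (grassWt 2 m) u a rfl),
      weightedHomogeneousComponent_of_mem
        (show _ ∈ weightedHomogeneousSubmodule (ZMod 2) (fun _ : Fin 2 => 1) _ from e2)]
    by_cases h : d = Finsupp.weight (grassWt 2 m) u
    · simp [h]
    · simp [h]

lemma tel (m : ℕ) (z : RootRing) :
    (1 + z) * ∑ j ∈ Finset.range (m + 1), z ^ (j + 1) = z + z ^ (m + 2) := by
  have h2 : (2 : RootRing) = 0 := by
    have : ((2 : ℕ) : RootRing) = 0 := CharP.cast_eq_zero RootRing 2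
    simpa using this
  induction m with
  | zero => simp; ring
  | succ m ih =>
    rw [Finset.sum_range_succ, mul_add, ih]
    linear_combination z ^ (m + 2) * h2

lemma rootMap_rel (m : ℕ) : rootMap m (grassRel 2 m) * (X 0 - X 1) =
    X 0 ^ (m + 2) * (1 + X 1) - X 1 ^ (m + 2) * (1 + X 0) := by
  have hs : (1 + ∑ j : Fin m, hsym (j + 1)) * (X 0 - X 1) =
      ∑ j ∈ Finset.range (m + 1), (X 0 : RootRing) ^ (j + 1)
        - ∑ j ∈ Finset.range (m + 1), (X 1 : RootRing) ^ (j + 1) := by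
    have h0 : (1 : RootRing) = hsym 0 := by simp [hsym]
    rw [← Finset.sum_sub_distrib, Fin.sum_univ_eq_sum_range (fun j => hsym (j + 1)) m, h0, add_comm,
      ← Finset.sum_range_succ' hsym, Finset.sum_mul]
    exact Finset.sum_congr rfl fun j _ => hsym_mul j
  have e : rootMap m (grassRel 2 m) =
      (1 + (X 0 + X 1 + X 0 * X 1)) * (1 + ∑ j : Fin m, hsym (j + 1)) - 1 := by
    simp [rootMap, grassRel, rootVal]
  rw [e]
  linear_combination (1 + X 0 + X 1 + X 0 * X 1) * hs + (1 + X 1) * tel m (X 0)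
    - (1 + X 0) * tel m (X 1)

/-- Both exponents below `N` implies vanishing coefficient. -/
def monIdeal (N : ℕ) : Ideal RootRing :=
  Ideal.span ((fun s => monomial s (1 : ZMod 2)) '' {Finsupp.single 0 N, Finsupp.single 1 N})

lemma X_pow_mem (N : ℕ) (i : Fin 2) : (X i : RootRing) ^ N ∈ monIdeal N := by
  rw [X_pow_eq_monomial]
  refine Ideal.subset_span ⟨_, ?_, rfl⟩
  fin_cases i <;> simp

lemma comp_mem (N d : ℕ) (p : RootRing) (hp : p ∈ monIdeal N) :
    weightedHomogeneousComponent (fun _ : Fin 2 => 1) d p ∈ monIdeal N := by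
  rw [monIdeal, mem_ideal_span_monomial_image] at *
  intro xi hxi
  rw [support_weightedHomogeneousComponent, Finset.mem_filter] at hxi
  exact hp xi hxi.1

lemma grass_le (m : ℕ) (p : MvPolynomial (Fin 2 ⊕ Fin m) (ZMod 2)) (hp : p ∈ grassIdeal 2 m) :
    rootMap m p * (X 0 - X 1) ∈ monIdeal (m + 2) := by
  induction hp using Submodule.span_induction with
  | mem x hx =>
    obtain ⟨d, -, rfl⟩ := hx
    rw [rootMap_comp, rootMap_rel]
    apply comp_mem
    exact Ideal.sub_mem _ (Ideal.mul_mem_right _ _ (X_pow_mem _ _))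
      (Ideal.mul_mem_right _ _ (X_pow_mem _ _))
  | zero => simp
  | add x y _ _ hx hy => rw [map_add, add_mul]; exact Ideal.add_mem _ hx hy
  | smul a x _ hx =>
    rw [smul_eq_mul, map_mul, mul_assoc]; exact Ideal.mul_mem_left _ _ hx

lemma coeff_XX (a b c d : ℕ) :
    coeff (Finsupp.single 0 a + Finsupp.single 1 b) ((X 0 : RootRing) ^ c * X 1 ^ d) =
      if c = a ∧ d = b then 1 else 0 := by
  rw [X_pow_eq_monomial, X_pow_eq_monomial, monomial_mul, coeff_monomial, one_mul]
  congr 1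
  rw [eq_iff_iff, Finsupp.ext_iff, Fin.forall_fin_two]
  simp

/-- If `2^s < n ≤ 2^{s+1}` and `n ≥ 4`, then `w_1^{2^s} · w_2^{n-2^s-1} ≠ 0` in `A(2,n)`,
and this element has degree `2(n-2) - 2^s + 2`. -/
theorem g2n_nonzero (s n : ℕ) (hs : 1 ≤ s) (h1 : 2 ^ s < n) (h2 : n ≤ 2 ^ (s + 1))
    (h4 : 4 ≤ n) :
    sw 2 (n - 2) 0 ^ (2 ^ s) * sw 2 (n - 2) 1 ^ (n - 2 ^ s - 1) ≠ 0 ∧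
    IsWeightedHomogeneous (grassWt 2 (n - 2))
      ((X (Sum.inl 0) : MvPolynomial (Fin 2 ⊕ Fin (n - 2)) (ZMod 2)) ^ (2 ^ s)
        * X (Sum.inl 1) ^ (n - 2 ^ s - 1))
      (2 * (n - 2) - 2 ^ s + 2) := by
  have hpow : 2 ≤ 2 ^ s := by
    calc 2 = 2 ^ 1 := rfl
      _ ≤ 2 ^ s := Nat.pow_le_pow_right (by norm_num) hs
  constructor
  · intro h
    simp only [sw, ← map_pow, ← map_mul] at h
    rw [Ideal.Quotient.eq_zero_iff_mem] at h
    have h' := grass_le _ _ h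
    rw [show n - 2 + 2 = n by omega] at h'
    obtain ⟨r, hr⟩ : ∃ r, n = 2 ^ s + 1 + r := ⟨n - 2 ^ s - 1, by omega⟩
    have e : rootMap (n - 2) (X (Sum.inl 0) ^ 2 ^ s * X (Sum.inl 1) ^ (n - 2 ^ s - 1))
        * (X 0 - X 1) =
        (X 0 ^ n * X 1 ^ r - X 0 ^ (n - 1) * X 1 ^ (r + 1)
          + X 0 ^ (r + 1) * X 1 ^ (n - 1) - X 0 ^ r * X 1 ^ n : RootRing) := by
      have hF : (X 0 + X 1 : RootRing) ^ 2 ^ s = X 0 ^ 2 ^ s + X 1 ^ 2 ^ s :=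
        add_pow_char_pow (p := 2) (n := s) (X 0) (X 1)
      have : n - 2 ^ s - 1 = r := by omega
      have h3 : n - 1 = 2 ^ s + r := by omega
      rw [this, h3, hr]
      simp only [rootMap, rootVal, map_mul, map_pow, aeval_X, Sum.elim_inl,
        Matrix.cons_val_zero, Matrix.cons_val_one]
      rw [hF]
      ring
    rw [e, monIdeal, mem_ideal_span_monomial_image] at h'
    obtain ⟨si, h5, h6⟩ := h' (Finsupp.single 0 (n - 1) + Finsupp.single 1 (r + 1)) (by
      rw [mem_support_iff]
      simp only [coeff_sub, coeff_add, coeff_XX]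
      rw [if_neg (show ¬(n = n - 1 ∧ r = r + 1) by omega),
        if_pos (show True ∧ True from ⟨trivial, trivial⟩),
        if_neg (show ¬(r + 1 = n - 1 ∧ n - 1 = r + 1) by omega),
        if_neg (show ¬(r = n - 1 ∧ n = r + 1) by omega)]
      decide)
    have h7 := h6 0
    have h8 := h6 1
    rcases h5 with rfl | rfl
    · simp at h7
      omega
    · simp at h8
      omega
  · have := ((isWeightedHomogeneous_X (ZMod 2) (grassWt 2 (n - 2)) (Sum.inl 0)).pow (2 ^ s)).mul
      ((isWeightedHomogeneous_X (ZMod 2) (grassWt 2 (n - 2)) (Sum.inl 1)).pow (n - 2 ^ s - 1))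
    convert this using 1
    simp [grassWt]
    omega
end
end

section
/- Let s ≥ 1 and n be integers with 2^s < n ≤ 2^{s+1} and n ≥ 4. Then the product w_1^{2^s} · w_2^{n−2^s} is zero in A(2,n). -/
open MvPolynomial TensorProduct

noncomputable section

theorem g_double {R : Type*} [CommRing R] (h2 : (2 : R) = 0) (a b : R) (g : ℕ → R)
    (g0 : g 0 = 1) (g1 : g 1 = a) (hg : ∀ d, g (d + 2) = a * g (d + 1) + b * g d) (m : ℕ) :
    g (2 * m + 1) = a * g m ^ 2 ∧ g (2 * m + 2) = g (m + 1) ^ 2 + b * g m ^ 2 := by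
  induction m with
  | zero =>
    have := hg 0
    simp only [Nat.mul_zero, Nat.zero_add] at *
    rw [this, g0, g1]
    constructor <;> ring
  | succ m ih =>
    obtain ⟨i1, i2⟩ := ih
    have e1 := hg (2 * m + 1)
    have e2 := hg (2 * m + 2)
    have e3 := hg m
    have f1 : g (2 * (m + 1) + 1) = a * g (m + 1) ^ 2 := by
      rw [show 2 * (m + 1) + 1 = 2 * m + 1 + 2 by ring, e1,
        show 2 * m + 1 + 1 = 2 * m + 2 by ring, i1, i2]
      linear_combination (a * b * g m ^ 2) * h2
    refine ⟨f1, ?_⟩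
    rw [show 2 * (m + 1) + 2 = 2 * m + 2 + 2 by ring, e2,
      show 2 * m + 2 + 1 = 2 * (m + 1) + 1 by ring, f1, i2, show m + 1 + 1 = m + 2 by ring, e3]
    linear_combination (-a * b * g m * g (m + 1)) * h2

theorem g_pow {R : Type*} [CommRing R] (h2 : (2 : R) = 0) (a b : R) (g : ℕ → R)
    (g0 : g 0 = 1) (g1 : g 1 = a) (hg : ∀ d, g (d + 2) = a * g (d + 1) + b * g d) (t : ℕ) :
    a * g (2 ^ t - 1) = a ^ 2 ^ t := by
  induction t with
  | zero => simp [g0]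
  | succ t ih =>
    have hp : 0 < 2 ^ t := by positivity
    have := (g_double h2 a b g g0 g1 hg (2 ^ t - 1)).1
    rw [show 2 ^ (t + 1) - 1 = 2 * (2 ^ t - 1) + 1 by rw [pow_succ]; omega, this, pow_succ 2 t,
      pow_mul, ← ih]
    ring

theorem g_shift {R : Type*} [CommRing R] (a b : R) (g : ℕ → R)
    (hg : ∀ d, g (d + 2) = a * g (d + 1) + b * g d) (j : ℕ) :
    ∀ r, g (r + j) = 0 → g (r + j + 1) = 0 → b ^ j * g r = 0 ∧ b ^ j * g (r + 1) = 0 := by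
  induction j with
  | zero => intro r h h'; simp_all
  | succ j ih =>
    intro r h h'
    obtain ⟨i1, i2⟩ := ih (r + 1) (by rw [← h]; congr 1; ring) (by rw [← h']; congr 1; ring)
    have := hg r
    constructor
    · linear_combination i2 - a * i1 - b ^ j * this
    · linear_combination b * i1

/-- The dual classes, extended by `1` in degree zero and `0` beyond `m`. -/
def dualc (m : ℕ) : ℕ → MvPolynomial (Fin 2 ⊕ Fin m) (ZMod 2)
  | 0 => 1
  | j + 1 => if h : j < m then X (Sum.inr ⟨j, h⟩) else 0

theorem dualc_hom (m j : ℕ) : IsWeightedHomogeneous (grassWt 2 m) (dualc m j) j := by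
  cases j with
  | zero => exact isWeightedHomogeneous_one _ _
  | succ j =>
    simp only [dualc]
    split_ifs with h
    · exact isWeightedHomogeneous_X (ZMod 2) (grassWt 2 m) (Sum.inr ⟨j, h⟩)
    · exact isWeightedHomogeneous_zero _ _ _

theorem dualc_gt (m j : ℕ) (h : m < j) : dualc m j = 0 := by
  cases j with
  | zero => omega
  | succ j => simp [dualc, show ¬ j < m by omega]

theorem comp_hom {m : ℕ} {p : MvPolynomial (Fin 2 ⊕ Fin m) (ZMod 2)} {e : ℕ}
    (hp : IsWeightedHomogeneous (grassWt 2 m) p e) (d : ℕ) :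
    weightedHomogeneousComponent (grassWt 2 m) d p = if e = d then p else 0 := by
  split_ifs with h
  · subst h; exact hp.weightedHomogeneousComponent_same
  · exact hp.weightedHomogeneousComponent_ne d (Ne.symm h)

theorem rel_eq (m : ℕ) : grassRel 2 m = ∑ j ∈ Finset.range (m + 1), dualc m j
    + ∑ j ∈ Finset.range (m + 1), X (Sum.inl 0) * dualc m j
    + ∑ j ∈ Finset.range (m + 1), X (Sum.inl 1) * dualc m j - 1 := by
  have : ∑ j ∈ Finset.range (m + 1), dualc m j = 1 + ∑ j : Fin m, X (Sum.inr j) := by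
    rw [Finset.sum_range_succ', add_comm, Finset.sum_range]
    simp [dualc]
  rw [← Finset.mul_sum, ← Finset.mul_sum, this, grassRel, Fin.sum_univ_two]
  ring

theorem comp_rel (m d : ℕ) (hd : 0 < d) :
    weightedHomogeneousComponent (grassWt 2 m) d (grassRel 2 m) =
      dualc m d + X (Sum.inl 0) * dualc m (d - 1)
        + (if 2 ≤ d then X (Sum.inl 1) * dualc m (d - 2) else 0) := by
  have hX0 := isWeightedHomogeneous_X (ZMod 2) (grassWt 2 m) (Sum.inl 0)
  have hX1 := isWeightedHomogeneous_X (ZMod 2) (grassWt 2 m) (Sum.inl 1)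
  rw [rel_eq, map_sub, map_add, map_add, map_sum, map_sum, map_sum,
    comp_hom (isWeightedHomogeneous_one _ _), if_neg hd.ne, sub_zero]
  have key : ∀ (c : MvPolynomial (Fin 2 ⊕ Fin m) (ZMod 2)) (e : ℕ), 
      ∑ j ∈ Finset.range (m + 1), (if j = e then c * dualc m j else 0) = c * dualc m e := by
    intro c e
    rw [Finset.sum_ite_eq']
    split_ifs with h
    · rfl
    · rw [dualc_gt m e (by simpa using h), mul_zero]
  congr 1
  · congr 1
    · rw [← one_mul (dualc m d), ← key]
      refine Finset.sum_congr rfl fun j _ => ?_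
      rw [comp_hom (dualc_hom m j), one_mul]
    · rw [← key]
      refine Finset.sum_congr rfl fun j _ => ?_
      rw [comp_hom (hX0.mul (dualc_hom m j))]
      congr 1
      simp only [grassWt, Sum.elim_inl, Fin.val_zero, eq_iff_iff]
      omega
  · split_ifs with h
    · rw [← key]
      refine Finset.sum_congr rfl fun j _ => ?_
      rw [comp_hom (hX1.mul (dualc_hom m j))]
      congr 1
      simp only [grassWt, Sum.elim_inl, Fin.val_one, eq_iff_iff]
      omega
    · refine Finset.sum_eq_zero fun j _ => ?_
      rw [comp_hom (hX1.mul (dualc_hom m j)), if_neg]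
      simp only [grassWt, Sum.elim_inl, Fin.val_one]
      omega

/-- If `2^s < n ≤ 2^{s+1}` and `n ≥ 4`, then `w_1^{2^s} · w_2^{n-2^s} = 0` in `A(2,n)`. -/
theorem g2n_zero (s n : ℕ) (hs : 1 ≤ s) (h1 : 2 ^ s < n) (h2 : n ≤ 2 ^ (s + 1))
    (h4 : 4 ≤ n) :
    sw 2 (n - 2) 0 ^ (2 ^ s) * sw 2 (n - 2) 1 ^ (n - 2 ^ s) = 0 := by
  obtain ⟨m, rfl⟩ : ∃ m, n = m + 2 := ⟨n - 2, by omega⟩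
  rw [show m + 2 - 2 = m by omega]
  set q := Ideal.Quotient.mk (grassIdeal 2 m) with hq
  have two : (2 : GrassCoh 2 m) = 0 := by
    have h : (2 : MvPolynomial (Fin 2 ⊕ Fin m) (ZMod 2)) = 0 := CharTwo.two_eq_zero
    have := congrArg q h
    rwa [map_ofNat, map_zero] at this
  have hrel : ∀ d, 0 < d →
      q (weightedHomogeneousComponent (grassWt 2 m) d (grassRel 2 m)) = 0 := fun d hd =>
    Ideal.Quotient.eq_zero_iff_mem.2 (Ideal.subset_span ⟨d, hd, rfl⟩)
  have g0 : q (dualc m 0) = 1 := map_one q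
  have g1 : q (dualc m 1) = sw 2 m 0 := by
    have := hrel 1 one_pos
    rw [comp_rel m 1 one_pos] at this
    simp only [map_add, map_mul, Nat.sub_self, g0, mul_one] at this
    rw [if_neg (by norm_num), map_zero, add_zero] at this
    change _ + sw 2 m 0 = 0 at this
    linear_combination this - sw 2 m 0 * two
  have hg : ∀ d, q (dualc m (d + 2)) =
      sw 2 m 0 * q (dualc m (d + 1)) + sw 2 m 1 * q (dualc m d) := by
    intro d
    have := hrel (d + 2) (by omega)
    rw [comp_rel m (d + 2) (by omega), if_pos (by omega), show d + 2 - 1 = d + 1 by omega,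
      show d + 2 - 2 = d by omega, map_add, map_add, map_mul, map_mul] at this
    change _ + sw 2 m 0 * _ + sw 2 m 1 * _ = 0 at this
    linear_combination this -
      (sw 2 m 0 * q (dualc m (d + 1)) + sw 2 m 1 * q (dualc m d)) * two
  have hz : ∀ j, m < j → q (dualc m j) = 0 := fun j hj => by rw [dualc_gt m j hj, map_zero]
  have hp : 0 < 2 ^ s := by positivity
  have e := (g_shift _ _ (fun j => q (dualc m j)) hg (m + 2 - 2 ^ s) (2 ^ s - 1)
    (hz _ (by omega)) (hz _ (by omega))).1
  have f := g_pow two _ _ (fun j => q (dualc m j)) g0 g1 hg s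
  rw [← f]
  linear_combination sw 2 m 0 * e
end
end

section
/- Let s ≥ 1 and n be integers with 2^s < n ≤ 2^{s+1} and n ≥ 4. Then the product w_1^{2^{s+1}−2} · w_2^{n−2^s−1} is a nonzero element of A(2,n); it lies in the top degree 2(n−2), which equals the dimension of G_2(ℝ^n). -/
open MvPolynomial TensorProduct

noncomputable section

/-- Complete homogeneous symmetric polynomial in two variables. -/
def hh {R : Type*} [CommRing R] (a b : R) (j : ℕ) : R :=
  ∑ i ∈ Finset.range (j + 1), a ^ i * b ^ (j - i)

theorem hh_mul {R : Type*} [CommRing R] (a b : R) (j : ℕ) :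
    hh a b j * (a - b) = a ^ (j + 1) - b ^ (j + 1) := by
  have := (Commute.all a b).geom_sum₂_mul (j + 1)
  simpa [hh] using this

theorem key_rel {R : Type*} [CommRing R] (h2 : (2 : R) = 0) (a b : R) (m : ℕ)
    (ha : a ^ (m + 2) = 0) (hb : b ^ (m + 2) = 0) :
    (a - b) * ((1 + (a + b + a * b)) * (1 + ∑ j : Fin m, hh a b ((j : ℕ) + 1)) - 1) = 0 := by
  have e1 : (1 + ∑ j : Fin m, hh a b ((j : ℕ) + 1)) = ∑ j ∈ Finset.range (m + 1), hh a b j := by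
    rw [Finset.sum_range_succ', Fin.sum_univ_eq_sum_range (fun j => hh a b (j + 1)) m]
    simp [hh, add_comm]
  have e2 : (∑ j ∈ Finset.range (m + 1), hh a b j) * (a - b)
      = ∑ j ∈ Finset.range (m + 2), a ^ j - ∑ j ∈ Finset.range (m + 2), b ^ j := by
    rw [Finset.sum_mul, Finset.sum_congr rfl (fun j _ => hh_mul a b j), Finset.sum_sub_distrib,
      Finset.sum_range_succ' _ (m + 1), Finset.sum_range_succ' _ (m + 1)]
    simp
  have ga : (∑ j ∈ Finset.range (m + 2), a ^ j) * (a - 1) = -1 := by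
    rw [geom_sum_mul, ha]; ring
  have gb : (∑ j ∈ Finset.range (m + 2), b ^ j) * (b - 1) = -1 := by
    rw [geom_sum_mul, hb]; ring
  rw [e1]
  generalize (∑ j ∈ Finset.range (m + 1), hh a b j) = H at *
  generalize (∑ j ∈ Finset.range (m + 2), a ^ j) = A at *
  generalize (∑ j ∈ Finset.range (m + 2), b ^ j) = B at *
  linear_combination (1 + (a + b + a * b)) * e2 + (b - 1) * ga - (a - 1) * gb
    + (A - B) * (a + b) * h2

theorem coeff_comp {σ S : Type*} [CommRing S] [Algebra (ZMod 2) S] (w : σ → ℕ) (f : σ → S)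
    (p : MvPolynomial σ (ZMod 2)) (d : ℕ) :
    (aeval (fun i => Polynomial.C (f i) * Polynomial.X ^ (w i)) p : Polynomial S).coeff d
      = aeval f (weightedHomogeneousComponent w d p) := by
  induction p using MvPolynomial.induction_on' with
  | monomial u a =>
    rw [aeval_monomial]
    have : (u.prod fun i k => (Polynomial.C (f i) * Polynomial.X ^ (w i)) ^ k)
        = Polynomial.C (u.prod fun i k => f i ^ k) * Polynomial.X ^ (Finsupp.weight w u) := by
      simp only [Finsupp.prod, mul_pow, Finset.prod_mul_distrib, Finsupp.weight_apply, Finsupp.sum,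
        ← pow_mul, Finset.prod_pow_eq_pow_sum, map_prod, map_pow, smul_eq_mul]
      congr 2
      exact Finset.sum_congr rfl fun i _ => mul_comm _ _
    rw [this, Polynomial.algebraMap_apply, ← mul_assoc, ← Polynomial.C_mul,
      Polynomial.coeff_C_mul_X_pow]
    by_cases h : d = Finsupp.weight w u
    · subst h
      rw [if_pos rfl, (isWeightedHomogeneous_monomial w u a rfl).weightedHomogeneousComponent_same,
        aeval_monomial]
    · rw [if_neg h, (isWeightedHomogeneous_monomial w u a rfl).weightedHomogeneousComponent_ne d
        h]
      simp
  | add p q hp hq => simp [hp, hq]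

/-- Images of the generators. -/
def gens {S : Type*} [CommRing S] (x y : S) (m : ℕ) : Fin 2 ⊕ Fin m → S :=
  Sum.elim ![x + y, x * y] (fun j => hh x y ((j : ℕ) + 1))

theorem ideal_ann {S : Type*} [CommRing S] [Algebra (ZMod 2) S] (x y : S) (m : ℕ)
    (hx : x ^ (m + 2) = 0) (hy : y ^ (m + 2) = 0) (p : MvPolynomial (Fin 2 ⊕ Fin m) (ZMod 2))
    (hp : p ∈ grassIdeal 2 m) : (x - y) * aeval (gens x y m) p = 0 := by
  have h2S : (2 : S) = 0 := by
    have : algebraMap (ZMod 2) S 2 = 0 := by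
      rw [show (2 : ZMod 2) = 0 from rfl, map_zero]
    rwa [map_ofNat] at this
  have key := key_rel (R := Polynomial S)
    (by rw [show (2 : Polynomial S) = Polynomial.C 2 from (map_ofNat _ 2).symm, h2S, map_zero])
    (Polynomial.C x * Polynomial.X) (Polynomial.C y * Polynomial.X) m
    (by rw [mul_pow, ← Polynomial.C_pow, hx]; simp) (by rw [mul_pow, ← Polynomial.C_pow, hy]; simp)
  have hrel : aeval (fun i => Polynomial.C (gens x y m i) * Polynomial.X ^ (grassWt 2 m i))
      (grassRel 2 m) = ((1 + (Polynomial.C x * Polynomial.X + Polynomial.C y * Polynomial.X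
        + (Polynomial.C x * Polynomial.X) * (Polynomial.C y * Polynomial.X)))
        * (1 + ∑ j : Fin m, hh (Polynomial.C x * Polynomial.X) (Polynomial.C y * Polynomial.X)
          ((j : ℕ) + 1)) - 1 : Polynomial S) := by
    have hj : ∀ j : ℕ, hh (Polynomial.C x * Polynomial.X) (Polynomial.C y * Polynomial.X) j
        = Polynomial.C (hh x y j) * Polynomial.X ^ j := by
      intro j
      rw [hh, hh, map_sum, Finset.sum_mul]
      refine Finset.sum_congr rfl fun i hi => ?_
      have : i ≤ j := by have := Finset.mem_range.1 hi; omega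
      obtain ⟨k, rfl⟩ := Nat.exists_eq_add_of_le this
      simp only [Nat.add_sub_cancel_left, map_mul, map_pow]
      ring
    simp only [hj]
    simp [grassRel, gens, grassWt, Fin.sum_univ_two]
    ring
  rw [← hrel] at key
  refine Submodule.span_induction (p := fun p _ => (x - y) * aeval (gens x y m) p = 0)
    ?_ ?_ ?_ ?_ hp
  · rintro q ⟨d, -, rfl⟩
    rw [← coeff_comp]
    have := congrArg (fun P => Polynomial.coeff P (d + 1)) key
    rw [← sub_mul, ← Polynomial.C_sub, mul_assoc] at this
    simpa only [Polynomial.coeff_C_mul, Polynomial.coeff_X_mul, Polynomial.coeff_zero] using this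
  · simp
  · intro a b _ _ ha hb
    rw [map_add, mul_add, ha, hb, add_zero]
  · intro a b _ hb
    rw [smul_eq_mul, map_mul, mul_left_comm, hb, mul_zero]

theorem pow_eq_hh (k : ℕ) :
    (X 0 - X 1 : MvPolynomial (Fin 2) (ZMod 2)) ^ (2 ^ k - 1) = hh (X 0) (X 1) (2 ^ k - 1) := by
  have hne : (X 0 - X 1 : MvPolynomial (Fin 2) (ZMod 2)) ≠ 0 := by
    rw [sub_ne_zero]
    intro h
    exact absurd (X_injective h) (by decide)
  apply mul_right_cancel₀ hne
  rw [hh_mul, ← pow_succ, Nat.sub_add_cancel Nat.one_le_two_pow, sub_pow_char_pow]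

theorem not_mem (s n : ℕ) (h1 : 2 ^ s < n) :
    (X 0 - X 1 : MvPolynomial (Fin 2) (ZMod 2)) ^ (2 ^ (s + 1) - 1) *
      (X 0 * X 1) ^ (n - 2 ^ s - 1) ∉
      Ideal.span {(X 0 ^ n : MvPolynomial (Fin 2) (ZMod 2)), X 1 ^ n} := by
  intro hmem
  rw [pow_eq_hh] at hmem
  obtain ⟨c, rfl⟩ : ∃ c, n = 2 ^ s + 1 + c := Nat.exists_eq_add_of_le h1
  have hc : 2 ^ s + 1 + c - 2 ^ s - 1 = c := by omega
  rw [hc] at hmem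
  have hpos := Nat.one_le_two_pow (n := s)
  have hps : 2 ^ (s + 1) = 2 * 2 ^ s := by ring
  set N := 2 ^ s with hN
  obtain ⟨a, b, hab⟩ := Submodule.mem_span_pair.1 hmem
  let e : Fin 2 →₀ ℕ := Finsupp.single 0 (N + c) + Finsupp.single 1 (N - 1 + c)
  have hco := congrArg (coeff e) hab
  have hmon : ∀ i j : ℕ, (X 0 ^ i * X 1 ^ j : MvPolynomial (Fin 2) (ZMod 2))
      = monomial (Finsupp.single 0 i + Finsupp.single 1 j) 1 := by
    intro i j
    rw [X_pow_eq_monomial, X_pow_eq_monomial, monomial_mul, one_mul]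
  have hL : coeff e (a • (X 0 ^ (N + 1 + c) : MvPolynomial (Fin 2) (ZMod 2))
      + b • X 1 ^ (N + 1 + c)) = 0 := by
    rw [coeff_add, smul_eq_mul, smul_eq_mul, X_pow_eq_monomial, X_pow_eq_monomial,
      coeff_mul_monomial', coeff_mul_monomial', if_neg, if_neg, add_zero]
    · intro h
      have := h 1
      simp [e] at this
      omega
    · intro h
      have := h 0
      simp [e] at this
  have hR : coeff e (hh (X 0) (X 1) (2 ^ (s + 1) - 1) * (X 0 * X 1) ^ c :
      MvPolynomial (Fin 2) (ZMod 2)) = 1 := by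
    rw [hh, Finset.sum_mul, coeff_sum, Finset.sum_eq_single N]
    · rw [mul_pow, mul_mul_mul_comm, ← pow_add, ← pow_add, hmon, coeff_monomial, if_pos]
      have : 2 ^ (s + 1) - 1 - N = N - 1 := by omega
      rw [this]
    · intro i _ hi
      rw [mul_pow, mul_mul_mul_comm, ← pow_add, ← pow_add, hmon, coeff_monomial, if_neg]
      intro h
      have := DFunLike.congr_fun h 0
      simp [e] at this
      omega
    · intro h
      exact absurd (Finset.mem_range.2 (by omega)) h
  rw [hL, hR] at hco
  exact absurd hco (by decide)

/-- If `2^s < n ≤ 2^{s+1}` and `n ≥ 4`, then `w_1^{2^{s+1}-2} · w_2^{n-2^s-1} ≠ 0` in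
`A(2,n)`; it lies in the top degree `2(n-2)`, which equals the dimension of `G_2(ℝ^n)`. -/
theorem g2n_top_nonzero (s n : ℕ) (hs : 1 ≤ s) (h1 : 2 ^ s < n) (h2 : n ≤ 2 ^ (s + 1))
    (h4 : 4 ≤ n) :
    sw 2 (n - 2) 0 ^ (2 ^ (s + 1) - 2) * sw 2 (n - 2) 1 ^ (n - 2 ^ s - 1) ≠ 0 ∧
    IsWeightedHomogeneous (grassWt 2 (n - 2))
      ((X (Sum.inl 0) : MvPolynomial (Fin 2 ⊕ Fin (n - 2)) (ZMod 2)) ^ (2 ^ (s + 1) - 2)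
        * X (Sum.inl 1) ^ (n - 2 ^ s - 1))
      (2 * (n - 2)) ∧
    2 * (n - 2) = 2 * (n - 2) := by
  refine ⟨?_, ?_, rfl⟩
  · intro h0
    simp only [sw, ← map_pow, ← map_mul] at h0
    rw [Ideal.Quotient.eq_zero_iff_mem] at h0
    obtain ⟨m, rfl⟩ : ∃ m, n = m + 2 := ⟨n - 2, by omega⟩
    rw [Nat.add_sub_cancel] at h0
    let I : Ideal (MvPolynomial (Fin 2) (ZMod 2)) := Ideal.span {X 0 ^ (m + 2), X 1 ^ (m + 2)}
    have hx : (Ideal.Quotient.mk I (X 0)) ^ (m + 2) = 0 := by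
      rw [← map_pow, Ideal.Quotient.eq_zero_iff_mem]
      exact Ideal.subset_span (by simp)
    have hy : (Ideal.Quotient.mk I (X 1)) ^ (m + 2) = 0 := by
      rw [← map_pow, Ideal.Quotient.eq_zero_iff_mem]
      exact Ideal.subset_span (by simp)
    have hann := ideal_ann _ _ m hx hy _ h0
    have hadd : (X 0 + X 1 : MvPolynomial (Fin 2) (ZMod 2)) = X 0 - X 1 :=
      (CharTwo.sub_eq_add _ _).symm
    simp only [map_mul, map_pow, aeval_X, gens, Sum.elim_inl, Matrix.cons_val_zero,
      Matrix.cons_val_one] at hann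
    rw [← map_add, hadd, ← map_sub, ← map_mul, ← map_pow, ← map_pow, ← map_mul, ← map_mul,
      Ideal.Quotient.eq_zero_iff_mem, ← mul_assoc, ← pow_succ'] at hann
    have hpos : 2 ≤ 2 ^ (s + 1) := by
      rw [pow_succ]; have := Nat.one_le_two_pow (n := s); omega
    rw [show 2 ^ (s + 1) - 2 + 1 = 2 ^ (s + 1) - 1 by omega] at hann
    exact not_mem s (m + 2) h1 hann
  · have hd : 2 * (n - 2) = (2 ^ (s + 1) - 2) • grassWt 2 (n - 2) (Sum.inl 0)
        + (n - 2 ^ s - 1) • grassWt 2 (n - 2) (Sum.inl 1) := by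
      have := Nat.one_le_two_pow (n := s)
      simp [grassWt, pow_succ]
      omega
    rw [hd]
    exact ((isWeightedHomogeneous_X _ _ _).pow _).mul ((isWeightedHomogeneous_X _ _ _).pow _)
end
end

section
/- Let s ≥ 3 be an integer and put n = 2^s + 1. Then in A(3,n) the product w_1^{2^s} · w_2^{2^{s−1}} is nonzero, while the product w_1^{2^s} · w_2^{2^{s−1}} · w_3 is zero. -/
open MvPolynomial TensorProduct

noncomputable section

/-- substitution remembering degrees -/
def thetaHom {k m : ℕ} {B : Type*} [CommRing B] [Algebra (ZMod 2) B]
    (φ : MvPolynomial (Fin k ⊕ Fin m) (ZMod 2) →ₐ[ZMod 2] B) :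
    MvPolynomial (Fin k ⊕ Fin m) (ZMod 2) →ₐ[ZMod 2] PowerSeries B :=
  aeval (fun i => PowerSeries.C (φ (X i)) * PowerSeries.X ^ (grassWt k m i))

lemma coeff_thetaHom {k m : ℕ} {B : Type*} [CommRing B] [Algebra (ZMod 2) B]
    (φ : MvPolynomial (Fin k ⊕ Fin m) (ZMod 2) →ₐ[ZMod 2] B)
    (p : MvPolynomial (Fin k ⊕ Fin m) (ZMod 2)) (d : ℕ) :
    PowerSeries.coeff d (thetaHom φ p) =
      φ (weightedHomogeneousComponent (grassWt k m) d p) := by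
  induction p using MvPolynomial.induction_on' with
  | add p q hp hq => simp [hp, hq]
  | monomial u a =>
    have h1 : thetaHom φ (monomial u a) =
        PowerSeries.C (φ (monomial u a)) * PowerSeries.X ^ (Finsupp.weight (grassWt k m) u) := by
      have h0 : φ = aeval (fun i => φ (X i)) := by
        ext i; simp
      conv_rhs => rw [h0]
      rw [thetaHom, aeval_monomial, aeval_monomial]
      simp only [Finsupp.prod, mul_pow, Finset.prod_mul_distrib, map_mul, map_prod, map_pow,
        Finsupp.weight_apply, Finsupp.sum, ← pow_mul, Finset.prod_pow_eq_pow_sum, smul_eq_mul]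
      rw [PowerSeries.algebraMap_apply]
      simp only [mul_comm, mul_left_comm]
    rw [h1, PowerSeries.coeff_C_mul, PowerSeries.coeff_X_pow]
    by_cases hd : d = Finsupp.weight (grassWt k m) u
    · rw [hd, (isWeightedHomogeneous_monomial _ u a rfl).weightedHomogeneousComponent_same]
      simp
    · rw [(isWeightedHomogeneous_monomial _ u a rfl).weightedHomogeneousComponent_ne _ hd]
      simp [hd]

lemma two_zero_of_alg (B : Type*) [CommRing B] [Algebra (ZMod 2) B] : (2 : B) = 0 := by
  have h : (2 : ZMod 2) = 0 := rfl
  have := congrArg (algebraMap (ZMod 2) B) h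
  rwa [map_ofNat, map_zero] at this

lemma frob_add {B : Type*} [CommRing B] (h2 : (2 : B) = 0) (x y : B) (k : ℕ) :
    (x + y) ^ 2 ^ k = x ^ 2 ^ k + y ^ 2 ^ k := by
  induction k with
  | zero => simp
  | succ k ih =>
    rw [pow_succ, pow_mul, pow_mul, pow_mul, ih]
    linear_combination (x ^ 2 ^ k * y ^ 2 ^ k) * h2

lemma coeff_sq {B : Type*} [CommRing B] (h2 : (2 : B) = 0) (f : PowerSeries B) (j : ℕ) :
    PowerSeries.coeff (2 * j) (f ^ 2) = (PowerSeries.coeff j f) ^ 2 := by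
  rw [pow_two, PowerSeries.coeff_mul,
    ← Finset.add_sum_erase _ _ (show (j, j) ∈ Finset.HasAntidiagonal.antidiagonal (2 * j) by simp; omega)]
  rw [Finset.sum_involution (fun p _ => (p.2, p.1))]
  · simp [pow_two]
  · intro p _
    dsimp only
    linear_combination (PowerSeries.coeff p.1 f * PowerSeries.coeff p.2 f) * h2
  · rintro ⟨p, q⟩ hp _ h
    simp at hp h
    omega
  · rintro ⟨p, q⟩ hp
    simp at hp ⊢
    omega
  · rintro ⟨p, q⟩ hp
    rfl

lemma log_deriv_coeff {B : Type*} [CommRing B] (h2 : (2 : B) = 0) (e g : PowerSeries B)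
    (w1 w2 w3 : B)
    (he : e = 1 + (PowerSeries.C w1 * PowerSeries.X + PowerSeries.C w2 * PowerSeries.X ^ 2
      + PowerSeries.C w3 * PowerSeries.X ^ 3))
    (heg : e * g = 1) (s : ℕ) :
    PowerSeries.coeff (2 ^ s - 1)
      ((PowerSeries.C w1 + PowerSeries.C w3 * PowerSeries.X ^ 2) * g) = w1 ^ 2 ^ s := by
  have h2' : (2 : PowerSeries B) = 0 := by
    have := congrArg (PowerSeries.C (R := B)) h2
    rwa [map_ofNat, map_zero] at this
  set D := PowerSeries.derivative B with hD
  set u : PowerSeries B := PowerSeries.C w1 + PowerSeries.C w3 * PowerSeries.X ^ 2 with hu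
  have hDe : D e = u := by
    rw [he, hu]
    simp [hD, Derivation.leibniz, Derivation.leibniz_pow, PowerSeries.derivative_C]
    linear_combination (PowerSeries.C w2 * PowerSeries.X + PowerSeries.C w3 * PowerSeries.X ^ 2) * h2'
  have hDu : D u = 0 := by
    rw [hu]
    simp [hD, Derivation.leibniz, Derivation.leibniz_pow, PowerSeries.derivative_C]
    linear_combination (PowerSeries.C w3 * PowerSeries.X) * h2'
  have h1 : e * D g + g * u = 0 := by
    have := congrArg D heg
    simpa [Derivation.leibniz, hDe] using this
  have hf : D (u * g) = (u * g) ^ 2 := by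
    rw [Derivation.leibniz, hDu]
    simp only [smul_eq_mul, mul_zero, add_zero]
    linear_combination (-u * D g) * heg + (u * g) * h1 - (u * g) ^ 2 * h2'
  induction s with
  | zero =>
    have : PowerSeries.coeff 0 g = 1 := by
      have := congrArg (PowerSeries.coeff 0) heg
      rw [he] at this
      simpa using this
    simp at this
    simp [hu, this]
  | succ s ih =>
    have hN : 2 ^ (s + 1) - 1 = 2 * (2 ^ s - 1) + 1 := by
      have := Nat.one_le_two_pow (n := s)
      rw [pow_succ]; omega
    have h3 := congrArg (PowerSeries.coeff (2 * (2 ^ s - 1))) hf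
    rw [coeff_sq h2, ih, hD, PowerSeries.coeff_derivative] at h3
    rw [hN, pow_succ, pow_mul, ← h3]
    push_cast
    linear_combination (-(2 ^ s - 1 : ℕ) *
      PowerSeries.coeff (2 * (2 ^ s - 1) + 1) (u * g)) * h2

lemma theta_rel {m : ℕ} {B : Type*} [CommRing B] [Algebra (ZMod 2) B]
    (φ : MvPolynomial (Fin 3 ⊕ Fin m) (ZMod 2) →ₐ[ZMod 2] B) :
    thetaHom φ (grassRel 3 m) =
    (1 + (PowerSeries.C (φ (X (Sum.inl 0))) * PowerSeries.X
      + PowerSeries.C (φ (X (Sum.inl 1))) * PowerSeries.X ^ 2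
      + PowerSeries.C (φ (X (Sum.inl 2))) * PowerSeries.X ^ 3)) *
    (1 + ∑ j : Fin m, PowerSeries.C (φ (X (Sum.inr j))) * PowerSeries.X ^ ((j : ℕ) + 1)) - 1 := by
  simp [thetaHom, grassRel, grassWt, Fin.sum_univ_three]

lemma coeff_dual_zero {m : ℕ} {B : Type*} [CommRing B] (c : Fin m → B) (d : ℕ) (hd : m < d) :
    PowerSeries.coeff d (1 + ∑ j : Fin m, PowerSeries.C (c j) *
      PowerSeries.X ^ ((j : ℕ) + 1)) = 0 := by
  rw [map_add, map_sum, PowerSeries.coeff_one, if_neg (by omega), zero_add]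
  apply Finset.sum_eq_zero
  intro j _
  rw [PowerSeries.coeff_C_mul, PowerSeries.coeff_X_pow, if_neg (by omega), mul_zero]

lemma coeff_dual_le {m : ℕ} {B : Type*} [CommRing B] (c : ℕ → B) (h0 : c 0 = 1) (d : ℕ)
    (hd : d ≤ m) :
    PowerSeries.coeff d (1 + ∑ j : Fin m, PowerSeries.C (c ((j : ℕ) + 1)) *
      PowerSeries.X ^ ((j : ℕ) + 1)) = c d := by
  rw [map_add, map_sum, PowerSeries.coeff_one]
  simp only [PowerSeries.coeff_C_mul, PowerSeries.coeff_X_pow]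
  rcases d with _ | d
  · simp [h0]
  · rw [Finset.sum_eq_single (⟨d, by omega⟩ : Fin m)]
    · simp
    · intro j _ hj
      rw [if_neg, mul_zero]
      intro h
      apply hj
      ext
      simp
      omega
    · simp

lemma part_two (s : ℕ) (hs : 3 ≤ s) :
    sw 3 (2 ^ s - 2) 0 ^ 2 ^ s * sw 3 (2 ^ s - 2) 2 = 0 := by
  have hN : 8 ≤ 2 ^ s := by
    calc 8 = 2 ^ 3 := by norm_num
      _ ≤ 2 ^ s := Nat.pow_le_pow_right (by norm_num) hs
  set m := 2 ^ s - 2 with hm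
  let φ := Ideal.Quotient.mkₐ (ZMod 2) (grassIdeal 3 m)
  have h2 := two_zero_of_alg (GrassCoh 3 m)
  have hrel := theta_rel φ
  set w1 := φ (X (Sum.inl 0)) with hw1
  set w2 := φ (X (Sum.inl 1)) with hw2
  set w3 := φ (X (Sum.inl 2)) with hw3
  set g : PowerSeries (GrassCoh 3 m) :=
    1 + ∑ j : Fin m, PowerSeries.C (φ (X (Sum.inr j))) * PowerSeries.X ^ ((j : ℕ) + 1) with hg
  have hg0 : ∀ d, m < d → PowerSeries.coeff d g = 0 := fun d hd => coeff_dual_zero _ d hd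
  have hth : thetaHom φ (grassRel 3 m) = 0 := by
    ext d
    rcases Nat.eq_zero_or_pos d with rfl | hd
    · rw [hrel]
      simp [hg]
    · rw [coeff_thetaHom, map_zero]
      exact Ideal.Quotient.eq_zero_iff_mem.2 (Ideal.subset_span ⟨d, hd, rfl⟩)
  rw [hth] at hrel
  have heg := (sub_eq_zero.1 hrel.symm)
  have hlog := log_deriv_coeff h2 _ g w1 w2 w3 rfl heg s
  obtain ⟨r, hr⟩ : ∃ r, m = r + 1 := ⟨m - 1, by omega⟩
  have e1 : 2 ^ s - 1 = r + 2 := by omega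
  rw [e1] at hlog
  have c3 := congrArg (PowerSeries.coeff (r + 3)) heg
  have c4 := congrArg (PowerSeries.coeff (r + 4)) heg
  have x1 : ∀ (x : GrassCoh 3 m) (d : ℕ), PowerSeries.coeff (d + 1)
      (PowerSeries.C x * PowerSeries.X * g) = x * PowerSeries.coeff d g := by
    intro x d
    rw [mul_assoc, PowerSeries.coeff_C_mul, PowerSeries.coeff_succ_X_mul]
  have xn : ∀ (x : GrassCoh 3 m) (d k : ℕ), PowerSeries.coeff (d + k)
      (PowerSeries.C x * PowerSeries.X ^ k * g) = x * PowerSeries.coeff d g := by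
    intro x d k
    rw [mul_assoc, PowerSeries.coeff_C_mul, PowerSeries.coeff_X_pow_mul]
  simp only [add_mul, one_mul, map_add] at c3 c4 hlog
  rw [x1 w1 (r + 2), xn w2 (r + 1) 2, xn w3 r 3, hg0 _ (by omega), hg0 (r + 2) (by omega),
    PowerSeries.coeff_one, if_neg (by omega)] at c3
  rw [x1 w1 (r + 3), xn w2 (r + 2) 2, xn w3 (r + 1) 3, hg0 _ (by omega), hg0 (r + 2) (by omega),
    hg0 (r + 3) (by omega), PowerSeries.coeff_one, if_neg (by omega)] at c4
  rw [xn w3 r 2, PowerSeries.coeff_C_mul, hg0 (r + 2) (by omega)] at hlog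
  change w1 ^ 2 ^ s * w3 = 0
  linear_combination (-w3) * hlog + w3 * c3 - w2 * c4

/-- geometric series -/
def geo {B : Type*} [CommRing B] (a : B) : PowerSeries B := PowerSeries.mk (fun j => a ^ j)

lemma geo_mul {B : Type*} [CommRing B] (h2 : (2 : B) = 0) (a : B) :
    (1 + PowerSeries.C a * PowerSeries.X) * geo a = 1 := by
  ext d
  rcases d with _ | d
  · simp [geo]
  · rw [add_mul, one_mul, mul_assoc, map_add, PowerSeries.coeff_C_mul,
      PowerSeries.coeff_succ_X_mul, PowerSeries.coeff_one, if_neg (by omega)]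
    simp only [geo, PowerSeries.coeff_mk]
    linear_combination a ^ (d + 1) * h2

lemma ideal_kill {B : Type*} [CommRing B] [Algebra (ZMod 2) B] (m : ℕ) (a b c : B)
    (ha : a ^ (m + 3) = 0) (hb : b ^ (m + 3) = 0) (hc : c ^ (m + 3) = 0)
    (p q : ℕ)
    (hp : (X (Sum.inl 0) ^ p * X (Sum.inl 1) ^ q : MvPolynomial (Fin 3 ⊕ Fin m) (ZMod 2))
      ∈ grassIdeal 3 m) :
    (a + b) * (a + c) * (b + c) * ((a + b + c) ^ p * (a * b + a * c + b * c) ^ q) = 0 := by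
  have h2 := two_zero_of_alg B
  have h2' : (2 : PowerSeries B) = 0 := by
    have := congrArg (PowerSeries.C (R := B)) h2
    rwa [map_ofNat, map_zero] at this
  set G := geo a * geo b * geo c with hG
  set V := (a + b) * (a + c) * (b + c) with hV
  let φ : MvPolynomial (Fin 3 ⊕ Fin m) (ZMod 2) →ₐ[ZMod 2] B :=
    aeval (Sum.elim ![a + b + c, a * b + a * c + b * c, a * b * c]
      (fun j => PowerSeries.coeff ((j : ℕ) + 1) G))
  have hVG : PowerSeries.C V * G = PowerSeries.C (a ^ 2 * (b + c)) * geo a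
      + PowerSeries.C (b ^ 2 * (a + c)) * geo b + PowerSeries.C (c ^ 2 * (a + b)) * geo c := by
    have h1 := geo_mul h2 a
    have h3 := geo_mul h2 b
    have h4 := geo_mul h2 c
    have hid : PowerSeries.C V =
        PowerSeries.C (a ^ 2 * (b + c)) * ((1 + PowerSeries.C b * PowerSeries.X) *
          (1 + PowerSeries.C c * PowerSeries.X))
        + PowerSeries.C (b ^ 2 * (a + c)) * ((1 + PowerSeries.C a * PowerSeries.X) *
          (1 + PowerSeries.C c * PowerSeries.X))
        + PowerSeries.C (c ^ 2 * (a + b)) * ((1 + PowerSeries.C a * PowerSeries.X) *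
          (1 + PowerSeries.C b * PowerSeries.X)) := by
      simp only [hV, map_mul, map_add, map_pow]
      generalize PowerSeries.C a = a'
      generalize PowerSeries.C b = b'
      generalize PowerSeries.C c = c'
      generalize (PowerSeries.X : PowerSeries B) = t
      linear_combination (a' * b' * c' - t * (a' ^ 2 * b' ^ 2 + a' ^ 2 * c' ^ 2 + b' ^ 2 * c' ^ 2
        + a' ^ 2 * b' * c' + a' * b' ^ 2 * c' + a' * b' * c' ^ 2)
        - t ^ 2 * a' * b' * c' * (a' * b' + a' * c' + b' * c')) * h2'
    rw [hid, hG]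
    generalize 1 + PowerSeries.C a * PowerSeries.X = a' at *
    generalize 1 + PowerSeries.C b * PowerSeries.X = b' at *
    generalize 1 + PowerSeries.C c * PowerSeries.X = c' at *
    generalize PowerSeries.C (a ^ 2 * (b + c)) = u
    generalize PowerSeries.C (b ^ 2 * (a + c)) = v
    generalize PowerSeries.C (c ^ 2 * (a + b)) = w
    have k1 : b' * c' * (geo a * geo b * geo c) = geo a := by
      linear_combination (geo a * c' * geo c) * h3 + geo a * h4
    have k2 : a' * c' * (geo a * geo b * geo c) = geo b := by
      linear_combination (geo b * c' * geo c) * h1 + geo b * h4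
    have k3 : a' * b' * (geo a * geo b * geo c) = geo c := by
      linear_combination (geo c * b' * geo b) * h1 + geo c * h3
    linear_combination u * k1 + v * k2 + w * k3
  have hpow : ∀ x : B, x ^ (m + 3) = 0 → ∀ d, m < d → x ^ 2 * x ^ d = 0 := by
    intro x hx d hd
    obtain ⟨k, rfl⟩ : ∃ k, d = m + 1 + k := ⟨d - (m + 1), by omega⟩
    linear_combination x ^ k * hx
  have hz : ∀ d, m < d → V * PowerSeries.coeff d G = 0 := by
    intro d hd
    rw [← PowerSeries.coeff_C_mul, hVG]
    simp only [map_add, PowerSeries.coeff_C_mul, geo, PowerSeries.coeff_mk]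
    linear_combination (b + c) * hpow a ha d hd + (a + c) * hpow b hb d hd
      + (a + b) * hpow c hc d hd
  have hG0 : PowerSeries.coeff 0 G = 1 := by
    simp [hG, geo]
  have hrel := theta_rel φ
  have f0 : φ (X (Sum.inl 0)) = a + b + c := by simp [φ]
  have f1 : φ (X (Sum.inl 1)) = a * b + a * c + b * c := by simp [φ]
  have f2 : φ (X (Sum.inl 2)) = a * b * c := by simp [φ]
  have f3 : ∀ j : Fin m, φ (X (Sum.inr j)) = PowerSeries.coeff ((j : ℕ) + 1) G := by
    intro j; simp [φ]
  simp only [f0, f1, f2, f3] at hrel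
  set g : PowerSeries B := 1 + ∑ j : Fin m, PowerSeries.C (PowerSeries.coeff ((j : ℕ) + 1) G) *
    PowerSeries.X ^ ((j : ℕ) + 1) with hg
  have hVg : PowerSeries.C V * g = PowerSeries.C V * G := by
    ext d
    rw [PowerSeries.coeff_C_mul, PowerSeries.coeff_C_mul]
    rcases Nat.lt_or_ge m d with hd | hd
    · rw [hz d hd, hg, coeff_dual_zero _ d hd, mul_zero]
    · rw [hg, coeff_dual_le (fun d => PowerSeries.coeff d G) hG0 d hd]
  have hVrel : PowerSeries.C V * thetaHom φ (grassRel 3 m) = 0 := by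
    have h1 := geo_mul h2 a
    have h3 := geo_mul h2 b
    have h4 := geo_mul h2 c
    have heG : (1 + (PowerSeries.C (a + b + c) * PowerSeries.X
        + PowerSeries.C (a * b + a * c + b * c) * PowerSeries.X ^ 2
        + PowerSeries.C (a * b * c) * PowerSeries.X ^ 3)) * G = 1 := by
      have : ∀ x y z : PowerSeries B, x = 1 → y = 1 → z = 1 → x * y * z = 1 := by
        rintro _ _ _ rfl rfl rfl; simp
      refine Eq.trans ?_ (this _ _ _ h1 h3 h4)
      rw [hG]
      simp only [map_mul, map_add]
      ring
    rw [hrel]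
    linear_combination (1 + (PowerSeries.C (a + b + c) * PowerSeries.X
        + PowerSeries.C (a * b + a * c + b * c) * PowerSeries.X ^ 2
        + PowerSeries.C (a * b * c) * PowerSeries.X ^ 3)) * hVg + PowerSeries.C V * heG
  have hall : ∀ x ∈ grassIdeal 3 m, V * φ x = 0 := by
    intro x hx
    refine Submodule.span_induction ?_ ?_ ?_ ?_ hx
    · rintro x ⟨d, hd, rfl⟩
      rw [← coeff_thetaHom, ← PowerSeries.coeff_C_mul, hVrel, map_zero]
    · simp
    · intro x y _ _ h1 h2
      rw [map_add, mul_add, h1, h2, add_zero]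
    · intro r x _ h1
      rw [smul_eq_mul, map_mul]
      linear_combination φ r * h1
  have := hall _ hp
  rwa [map_mul, map_pow, map_pow, f0, f1] at this

lemma top_calc {B : Type*} [CommRing B] (h2 : (2 : B) = 0) (t : ℕ) (a b c : B)
    (k : ℕ) (hk : 2 ^ t = k + 3)
    (ha : a ^ (2 ^ (t + 1) + 1) = 0) (hb : b ^ (2 ^ (t + 1) + 1) = 0)
    (hc : c ^ (2 ^ (t + 1) + 1) = 0)
    (h : (a + b) * (a + c) * (b + c) * ((a + b + c) ^ 2 ^ (t + 1) *
      (a * b + a * c + b * c) ^ 2 ^ t) = 0) :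
    a ^ 2 ^ (t + 1) * b ^ 2 ^ (t + 1) * c ^ 2 ^ (t + 1) = 0 := by
  rw [frob_add h2, frob_add h2, frob_add h2, frob_add h2] at h
  have hk2 : 2 ^ (t + 1) = 2 * k + 6 := by rw [pow_succ]; omega
  rw [hk2, hk] at h
  rw [hk2] at ha hb hc ⊢
  have h' := congrArg (fun z => b ^ (k + 1) * c ^ (k + 2) * z) h
  simp only [mul_zero] at h'
  linear_combination h'
    - (a ^ 4 * b ^ 5 * c ^ 2 * (a ^ k) * (b ^ k) ^ 2 * (c ^ k)
      + a ^ 4 * b ^ 2 * c ^ 5 * (a ^ k) * (b ^ k) * (c ^ k) ^ 2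
      + a * b ^ 5 * c ^ 5 * (b ^ k) ^ 2 * (c ^ k) ^ 2
      + a ^ 4 * b ^ 4 * c ^ 3 * (a ^ k) * (b ^ k) ^ 2 * (c ^ k)
      + a ^ 4 * b * c ^ 6 * (a ^ k) * (b ^ k) * (c ^ k) ^ 2
      + a * b ^ 4 * c ^ 6 * (b ^ k) ^ 2 * (c ^ k) ^ 2
      + 2 * a ^ 3 * b ^ 5 * c ^ 3 * (a ^ k) * (b ^ k) ^ 2 * (c ^ k)
      + 2 * a ^ 3 * b ^ 2 * c ^ 6 * (a ^ k) * (b ^ k) * (c ^ k) ^ 2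
      + 2 * b ^ 5 * c ^ 6 * (b ^ k) ^ 2 * (c ^ k) ^ 2
      + a ^ 3 * b ^ 4 * c ^ 4 * (a ^ k) * (b ^ k) ^ 2 * (c ^ k)
      + a ^ 3 * b * c ^ 7 * (a ^ k) * (b ^ k) * (c ^ k) ^ 2
      + b ^ 4 * c ^ 7 * (b ^ k) ^ 2 * (c ^ k) ^ 2
      + a ^ 3 * b ^ 6 * c ^ 2 * (a ^ k) * (b ^ k) ^ 2 * (c ^ k)
      + a ^ 3 * b ^ 3 * c ^ 5 * (a ^ k) * (b ^ k) * (c ^ k) ^ 2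
      + b ^ 6 * c ^ 5 * (b ^ k) ^ 2 * (c ^ k) ^ 2
      + a ^ 2 * b ^ 6 * c ^ 3 * (a ^ k) * (b ^ k) ^ 2 * (c ^ k)
      + a ^ 2 * b ^ 3 * c ^ 6 * (a ^ k) * (b ^ k) * (c ^ k) ^ 2
      + a ^ 2 * b ^ 5 * c ^ 4 * (a ^ k) * (b ^ k) ^ 2 * (c ^ k)
      + a ^ 2 * b ^ 2 * c ^ 7 * (a ^ k) * (b ^ k) * (c ^ k) ^ 2) * ha
    - (a ^ 5 * b ^ 4 * c ^ 2 * (a ^ k) * (b ^ k) ^ 2 * (c ^ k)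
      + a ^ 5 * b * c ^ 5 * (a ^ k) * (b ^ k) * (c ^ k) ^ 2
      + a ^ 2 * b ^ 4 * c ^ 5 * (b ^ k) ^ 2 * (c ^ k) ^ 2
      + a ^ 5 * b ^ 3 * c ^ 3 * (a ^ k) * (b ^ k) ^ 2 * (c ^ k)
      + a ^ 5 * c ^ 6 * (a ^ k) * (b ^ k) * (c ^ k) ^ 2
      + a ^ 2 * b ^ 3 * c ^ 6 * (b ^ k) ^ 2 * (c ^ k) ^ 2
      + 2 * a ^ 4 * b ^ 4 * c ^ 3 * (a ^ k) * (b ^ k) ^ 2 * (c ^ k)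
      + 2 * a ^ 4 * b * c ^ 6 * (a ^ k) * (b ^ k) * (c ^ k) ^ 2
      + 2 * a * b ^ 4 * c ^ 6 * (b ^ k) ^ 2 * (c ^ k) ^ 2
      + a ^ 4 * b ^ 3 * c ^ 4 * (a ^ k) * (b ^ k) ^ 2 * (c ^ k)
      + a ^ 4 * c ^ 7 * (a ^ k) * (b ^ k) * (c ^ k) ^ 2
      + a * b ^ 3 * c ^ 7 * (b ^ k) ^ 2 * (c ^ k) ^ 2
      + a ^ 4 * b ^ 5 * c ^ 2 * (a ^ k) * (b ^ k) ^ 2 * (c ^ k)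
      + a ^ 4 * b ^ 2 * c ^ 5 * (a ^ k) * (b ^ k) * (c ^ k) ^ 2
      + a * b ^ 5 * c ^ 5 * (b ^ k) ^ 2 * (c ^ k) ^ 2
      + a ^ 3 * b ^ 5 * c ^ 3 * (a ^ k) * (b ^ k) ^ 2 * (c ^ k)
      + a ^ 3 * b ^ 2 * c ^ 6 * (a ^ k) * (b ^ k) * (c ^ k) ^ 2
      + b ^ 5 * c ^ 6 * (b ^ k) ^ 2 * (c ^ k) ^ 2
      + a ^ 3 * b ^ 4 * c ^ 4 * (a ^ k) * (b ^ k) ^ 2 * (c ^ k)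
      + a ^ 3 * b * c ^ 7 * (a ^ k) * (b ^ k) * (c ^ k) ^ 2
      + b ^ 4 * c ^ 7 * (b ^ k) ^ 2 * (c ^ k) ^ 2) * hb
    - (a ^ 5 * b ^ 5 * c * (a ^ k) * (b ^ k) ^ 2 * (c ^ k)
      + a ^ 5 * b ^ 2 * c ^ 4 * (a ^ k) * (b ^ k) * (c ^ k) ^ 2
      + a ^ 2 * b ^ 5 * c ^ 4 * (b ^ k) ^ 2 * (c ^ k) ^ 2
      + a ^ 5 * b ^ 4 * c ^ 2 * (a ^ k) * (b ^ k) ^ 2 * (c ^ k)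
      + a ^ 5 * b * c ^ 5 * (a ^ k) * (b ^ k) * (c ^ k) ^ 2
      + a ^ 2 * b ^ 4 * c ^ 5 * (b ^ k) ^ 2 * (c ^ k) ^ 2
      + 2 * a ^ 4 * b ^ 5 * c ^ 2 * (a ^ k) * (b ^ k) ^ 2 * (c ^ k)
      + 2 * a ^ 4 * b ^ 2 * c ^ 5 * (a ^ k) * (b ^ k) * (c ^ k) ^ 2
      + 2 * a * b ^ 5 * c ^ 5 * (b ^ k) ^ 2 * (c ^ k) ^ 2
      + a ^ 4 * b ^ 4 * c ^ 3 * (a ^ k) * (b ^ k) ^ 2 * (c ^ k)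
      + a ^ 4 * b * c ^ 6 * (a ^ k) * (b ^ k) * (c ^ k) ^ 2
      + a * b ^ 4 * c ^ 6 * (b ^ k) ^ 2 * (c ^ k) ^ 2
      + a ^ 4 * b ^ 6 * c * (a ^ k) * (b ^ k) ^ 2 * (c ^ k)
      + a ^ 4 * b ^ 3 * c ^ 4 * (a ^ k) * (b ^ k) * (c ^ k) ^ 2
      + a * b ^ 6 * c ^ 4 * (b ^ k) ^ 2 * (c ^ k) ^ 2
      + a ^ 3 * b ^ 6 * c ^ 2 * (a ^ k) * (b ^ k) ^ 2 * (c ^ k)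
      + a ^ 3 * b ^ 3 * c ^ 5 * (a ^ k) * (b ^ k) * (c ^ k) ^ 2
      + b ^ 6 * c ^ 5 * (b ^ k) ^ 2 * (c ^ k) ^ 2
      + a ^ 6 * b ^ 5 * (a ^ k) ^ 2 * (b ^ k) ^ 2
      + a ^ 3 * b ^ 5 * c ^ 3 * (a ^ k) * (b ^ k) ^ 2 * (c ^ k)
      + a ^ 3 * b ^ 2 * c ^ 6 * (a ^ k) * (b ^ k) * (c ^ k) ^ 2
      + b ^ 5 * c ^ 6 * (b ^ k) ^ 2 * (c ^ k) ^ 2) * hc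

lemma top_ne (N : ℕ) :
    (X 0 ^ N * X 1 ^ N * X 2 ^ N : MvPolynomial (Fin 3) (ZMod 2)) ∉
      Ideal.span (Set.range fun i : Fin 3 => (X i : MvPolynomial (Fin 3) (ZMod 2)) ^ (N + 1)) := by
  intro h
  have hset : (Set.range fun i : Fin 3 => (X i : MvPolynomial (Fin 3) (ZMod 2)) ^ (N + 1)) =
      (fun u => monomial u (1 : ZMod 2)) '' (Set.range fun i : Fin 3 => Finsupp.single i (N + 1)) := by
    rw [← Set.range_comp]
    congr 1
    funext i
    simp [X_pow_eq_monomial]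
  rw [hset, mem_ideal_span_monomial_image] at h
  have hmon : (X 0 ^ N * X 1 ^ N * X 2 ^ N : MvPolynomial (Fin 3) (ZMod 2)) =
      monomial (Finsupp.single 0 N + Finsupp.single 1 N + Finsupp.single 2 N) 1 := by
    simp [X_pow_eq_monomial, monomial_mul]
  obtain ⟨_, ⟨i, rfl⟩, hi⟩ := h (Finsupp.single 0 N + Finsupp.single 1 N + Finsupp.single 2 N)
    (by rw [hmon, mem_support_iff, coeff_monomial, if_pos rfl]; exact one_ne_zero)
  have := hi i
  fin_cases i <;> simp at this

/-- For `s ≥ 3`, `n = 2^s + 1`: in `A(3,n)` the product `w_1^{2^s} · w_2^{2^{s-1}}` is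
nonzero, while `w_1^{2^s} · w_2^{2^{s-1}} · w_3` is zero. -/
theorem g3n_case1 (s : ℕ) (hs : 3 ≤ s) (n : ℕ) (hn : n = 2 ^ s + 1) :
    sw 3 (n - 3) 0 ^ (2 ^ s) * sw 3 (n - 3) 1 ^ (2 ^ (s - 1)) ≠ 0 ∧
    sw 3 (n - 3) 0 ^ (2 ^ s) * sw 3 (n - 3) 1 ^ (2 ^ (s - 1)) * sw 3 (n - 3) 2 = 0 := by
  subst hn
  have hm : 2 ^ s + 1 - 3 = 2 ^ s - 2 := by omega
  rw [hm]
  constructor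
  · intro h0
    obtain ⟨t, rfl⟩ : ∃ t, s = t + 1 := ⟨s - 1, by omega⟩
    rw [Nat.add_sub_cancel] at h0
    have ht : 4 ≤ 2 ^ t := by
      calc 4 = 2 ^ 2 := by norm_num
        _ ≤ 2 ^ t := Nat.pow_le_pow_right (by norm_num) (by omega)
    have hN : 2 ^ (t + 1) = 2 * 2 ^ t := by rw [pow_succ]; omega
    have hm3 : 2 ^ (t + 1) - 2 + 3 = 2 ^ (t + 1) + 1 := by omega
    let J := Ideal.span (Set.range fun i : Fin 3 =>
      (X i : MvPolynomial (Fin 3) (ZMod 2)) ^ (2 ^ (t + 1) + 1))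
    let q := Ideal.Quotient.mkₐ (ZMod 2) J
    have hq : ∀ i : Fin 3, q (X i) ^ (2 ^ (t + 1) + 1) = 0 := by
      intro i
      rw [← map_pow]
      exact Ideal.Quotient.eq_zero_iff_mem.2 (Ideal.subset_span ⟨i, rfl⟩)
    have hmem : (X (Sum.inl 0) ^ 2 ^ (t + 1) * X (Sum.inl 1) ^ 2 ^ t :
        MvPolynomial (Fin 3 ⊕ Fin (2 ^ (t + 1) - 2)) (ZMod 2)) ∈
        grassIdeal 3 (2 ^ (t + 1) - 2) := by
      rw [← Ideal.Quotient.eq_zero_iff_mem, map_mul, map_pow, map_pow]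
      exact h0
    have hk := ideal_kill (2 ^ (t + 1) - 2) (q (X 0)) (q (X 1)) (q (X 2))
      (by rw [hm3]; exact hq 0) (by rw [hm3]; exact hq 1) (by rw [hm3]; exact hq 2) _ _ hmem
    have hfin := top_calc (two_zero_of_alg _) t _ _ _ (2 ^ t - 3) (by omega)
      (hq 0) (hq 1) (hq 2) hk
    rw [← map_pow, ← map_pow, ← map_pow, ← map_mul, ← map_mul] at hfin
    exact top_ne _ (Ideal.Quotient.eq_zero_iff_mem.1 hfin)
  · rw [mul_right_comm, part_two s hs, zero_mul]
end
end

section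
/- Let s ≥ 3 be an integer and put n = 2^s + 2. Then in A(3,n) the product w_1^{2^s} · w_2^{2^{s−1}} · w_3 is nonzero, while the product w_1^{2^s} · w_2^{2^{s−1}} · w_3^2 is zero. -/
open MvPolynomial TensorProduct

noncomputable section

/-- The dual classes, extended by `1` in degree `0` and by zero above `m`. -/
def hX (m : ℕ) (j : ℕ) : MvPolynomial (Fin 3 ⊕ Fin m) (ZMod 2) :=
  if j = 0 then 1 else if h : j - 1 < m then X (Sum.inr ⟨j - 1, h⟩) else 0

/-- The classes `1, w_1, w_2, w_3`. -/
def wX (m : ℕ) (j : ℕ) : MvPolynomial (Fin 3 ⊕ Fin m) (ZMod 2) :=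
  if j = 0 then 1 else if h : j - 1 < 3 then X (Sum.inl ⟨j - 1, h⟩) else 0

lemma hX_hom (m j : ℕ) : IsWeightedHomogeneous (grassWt 3 m) (hX m j) j := by
  unfold hX
  split_ifs with h1 h2
  · subst h1; exact isWeightedHomogeneous_one _ _
  · have := isWeightedHomogeneous_X (ZMod 2) (grassWt 3 m) (Sum.inr ⟨j - 1, h2⟩)
    have e : grassWt 3 m (Sum.inr ⟨j - 1, h2⟩) = j := by
      simp only [grassWt, Sum.elim_inr]; omega
    rwa [e] at this
  · exact isWeightedHomogeneous_zero _ _ _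

lemma wX_hom (m j : ℕ) : IsWeightedHomogeneous (grassWt 3 m) (wX m j) j := by
  unfold wX
  split_ifs with h1 h2
  · subst h1; exact isWeightedHomogeneous_one _ _
  · have := isWeightedHomogeneous_X (ZMod 2) (grassWt 3 m) (Sum.inl ⟨j - 1, h2⟩)
    have e : grassWt 3 m (Sum.inl ⟨j - 1, h2⟩) = j := by
      simp only [grassWt, Sum.elim_inl]; omega
    rwa [e] at this
  · exact isWeightedHomogeneous_zero _ _ _

lemma hX_zero_of_lt (m j : ℕ) (h : m < j) : hX m j = 0 := by
  unfold hX
  rw [if_neg (by omega), dif_neg (by omega)]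

lemma grassRel_eq (m : ℕ) : grassRel 3 m =
    (∑ i ∈ Finset.range 4, wX m i) * (∑ j ∈ Finset.range (m + 1), hX m j) - 1 := by
  have h1 : (1 + ∑ i : Fin 3, X (Sum.inl i) : MvPolynomial (Fin 3 ⊕ Fin m) (ZMod 2)) =
      ∑ i ∈ Finset.range 4, wX m i := by
    rw [Finset.sum_range_succ', add_comm, Finset.sum_range]
    congr 1
  have h2 : (1 + ∑ i : Fin m, X (Sum.inr i) : MvPolynomial (Fin 3 ⊕ Fin m) (ZMod 2)) =
      ∑ i ∈ Finset.range (m + 1), hX m i := by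
    rw [Finset.sum_range_succ', add_comm, Finset.sum_range]
    congr 1
    apply Finset.sum_congr rfl
    intro i _
    simp [hX]
  rw [grassRel, h1, h2]

lemma comp_eq (m d : ℕ) (hd : 0 < d) :
    weightedHomogeneousComponent (grassWt 3 m) d (grassRel 3 m) =
      ∑ i ∈ Finset.range 4, if i ≤ d then wX m i * hX m (d - i) else 0 := by
  have h1 : weightedHomogeneousComponent (grassWt 3 m) d
      (1 : MvPolynomial (Fin 3 ⊕ Fin m) (ZMod 2)) = 0 := by
    rw [weightedHomogeneousComponent_of_mem (isWeightedHomogeneous_one _ _), if_neg (by omega)]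
  rw [grassRel_eq, map_sub, h1, sub_zero, Finset.sum_mul, map_sum]
  apply Finset.sum_congr rfl
  intro i _
  rw [Finset.mul_sum, map_sum]
  have h2 : ∀ j, weightedHomogeneousComponent (grassWt 3 m) d (wX m i * hX m j) =
      if i + j = d then wX m i * hX m j else 0 := by
    intro j
    have hh := (wX_hom m i).mul (hX_hom m j)
    split_ifs with h
    · rw [h] at hh
      rw [weightedHomogeneousComponent_of_mem hh, if_pos rfl]
    · rw [weightedHomogeneousComponent_of_mem hh, if_neg (by omega)]
  simp only [h2]
  split_ifs with hi
  · by_cases hm : d - i ≤ m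
    · rw [Finset.sum_eq_single (d - i)]
      · rw [if_pos (by omega)]
      · intro b _ hb; rw [if_neg (by omega)]
      · intro hb; simp at hb; omega
    · rw [hX_zero_of_lt m (d - i) (by omega), mul_zero]
      apply Finset.sum_eq_zero
      intro j hj
      simp at hj
      rw [if_neg (by omega)]
  · apply Finset.sum_eq_zero
    intro j _
    rw [if_neg (by omega)]

/-- Vanishing in a ring of characteristic two. -/
lemma vanish {A : Type*} [CommRing A] (h2 : (2 : A) = 0) (a b c : A) (h : ℕ → A) (q s : ℕ)
    (hq : q = 2 ^ s) (hq2 : 2 ≤ q)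
    (h0 : h 0 = 1) (h1 : h 1 = a) (hh2 : h 2 = a * h 1 + b)
    (hrec : ∀ k, h (k + 3) = a * h (k + 2) + b * h (k + 1) + c * h k)
    (hz : ∀ k, q ≤ k → h k = 0) : a ^ q * c ^ 2 = 0 := by
  let P : ℕ → A := fun k => match k with
    | 0 => 1
    | 1 => a
    | 2 => a ^ 2
    | (k + 3) => a * h (k + 2) + c * h k
  have hP3 : ∀ k, P (k + 3) = a * h (k + 2) + c * h k := fun k => rfl
  have P0 : P 0 = 1 := rfl
  have P1 : P 1 = a := rfl
  have P2 : P 2 = a ^ 2 := rfl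
  have h3 := hrec 0
  have h4 := hrec 1
  have h5 := hrec 2
  norm_num at h3 h4 h5
  have P3 := hP3 0
  have P4 := hP3 1
  have P5 := hP3 2
  norm_num at P3 P4 P5
  have hPrec : ∀ k, P (k + 3) = a * P (k + 2) + b * P (k + 1) + c * P k := by
    intro k
    match k with
    | 0 => show P 3 = a * P 2 + b * P 1 + c * P 0; rw [P3, P2, P1, P0, hh2, h1, h0]; ring
    | 1 =>
      norm_num; rw [P4, P3, P2, P1, h3, hh2, h1, h0]
      linear_combination (0 : A) * h2
    | 2 =>
      norm_num; rw [P5, P4, P3, P2, h4, h3, hh2, h1, h0]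
      linear_combination (0 : A) * h2
    | (k + 3) =>
      rw [show k + 3 + 2 = (k + 2) + 3 by ring, show k + 3 + 1 = (k + 1) + 3 by ring,
        hP3, hP3, hP3, hP3]
      have e1 := hrec (k + 2)
      have e2 := hrec k
      rw [show k + 2 + 2 = k + 1 + 3 by ring, show k + 2 + 1 = k + 3 by ring] at *
      have e3 := hrec (k + 1)
      rw [show k + 1 + 2 = k + 3 by ring, show k + 1 + 1 = k + 2 by ring] at *
      linear_combination a * e1 + c * e2
  have hP6 : ∀ k, P (k + 6) = a ^ 2 * P (k + 4) + b ^ 2 * P (k + 2) + c ^ 2 * P k := by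
    intro k
    have e0 := hPrec k
    have e1 := hPrec (k + 1)
    have e2 := hPrec (k + 2)
    have e3 := hPrec (k + 3)
    norm_num [add_assoc] at e0 e1 e2 e3
    linear_combination e3 + a * e2 + b * e1 + c * e0 +
      (a * b * P (k + 3) + a * c * P (k + 2) + b * c * P (k + 1)) * h2
      - (0 : A) * h2
  have hsq : ∀ k, P (2 * k) = P k ^ 2 ∧ P (2 * (k + 1)) = P (k + 1) ^ 2 ∧
      P (2 * (k + 2)) = P (k + 2) ^ 2 := by
    intro k
    induction k with
    | zero =>
      refine ⟨?_, ?_, ?_⟩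
      · show P 0 = P 0 ^ 2
        rw [P0]; ring
      · show P 2 = P 1 ^ 2
        rw [P1, P2]
      show P 4 = P 2 ^ 2
      rw [P4, P2, h3, hh2, h1, h0]
      linear_combination (a ^ 2 * b + a * c) * h2
    | succ k ih =>
      obtain ⟨i0, i1, i2⟩ := ih
      refine ⟨i1, by rw [show k + 1 + 1 = k + 2 by ring]; exact i2, ?_⟩
      have e := hP6 (2 * k)
      rw [show k + 1 + 2 = k + 3 by ring, show 2 * (k + 3) = 2 * k + 6 by ring, e,
        show 2 * k + 4 = 2 * (k + 2) by ring, show 2 * k + 2 = 2 * (k + 1) by ring, i0, i1, i2,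
        hPrec k]
      linear_combination (-(a * P (k + 2) * (b * P (k + 1)) + a * P (k + 2) * (c * P k)
        + b * P (k + 1) * (c * P k))) * h2
  have hpow : ∀ t, P (2 ^ t) = a ^ (2 ^ t) := by
    intro t
    induction t with
    | zero => simp [P1]
    | succ t ih => rw [pow_succ, mul_comm, (hsq _).1, ih, ← pow_mul, mul_comm]
  have hPq := hpow s
  rw [← hq] at hPq
  have key := hP6 q
  obtain ⟨r, rfl⟩ : ∃ r, q = r + 1 := ⟨q - 1, by omega⟩
  have z1 : P (r + 1 + 6) = 0 := by
    rw [show r + 1 + 6 = (r + 4) + 3 by ring, hP3, hz _ (by omega), hz _ (by omega)]; ring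
  have z2 : P (r + 1 + 4) = 0 := by
    rw [show r + 1 + 4 = (r + 2) + 3 by ring, hP3, hz _ (by omega), hz _ (by omega)]; ring
  have z3 : P (r + 1 + 2) = 0 := by
    rw [show r + 1 + 2 = r + 3 by ring, hP3, hz _ (by omega)]
    have := hrec r
    rw [hz _ (by omega), hz (r + 2) (by omega), hz (r + 1) (by omega)] at this
    linear_combination - this
  rw [z1, z2, z3, hPq] at key
  linear_combination - key

lemma vanish_coh (s m : ℕ) (hs : 3 ≤ s) (hm : m + 1 = 2 ^ s) :
    sw 3 m 0 ^ (2 ^ s) * sw 3 m 2 ^ 2 = 0 := by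
  have h2 : (2 : GrassCoh 3 m) = 0 := by
    have : (2 : MvPolynomial (Fin 3 ⊕ Fin m) (ZMod 2)) = 0 := CharTwo.two_eq_zero
    have := congrArg (Ideal.Quotient.mk (grassIdeal 3 m)) this
    rwa [map_zero, map_ofNat] at this
  have h8 : 2 ^ 3 ≤ 2 ^ s := Nat.pow_le_pow_right (by norm_num) hs
  have hrel : ∀ d, 0 < d → Ideal.Quotient.mk (grassIdeal 3 m)
      (∑ i ∈ Finset.range 4, if i ≤ d then wX m i * hX m (d - i) else 0) = 0 := by
    intro d hd
    rw [← comp_eq m d hd, Ideal.Quotient.eq_zero_iff_mem]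
    exact Ideal.subset_span ⟨d, hd, rfl⟩
  have w0 : wX m 0 = 1 := rfl
  have w1 : Ideal.Quotient.mk (grassIdeal 3 m) (wX m 1) = sw 3 m 0 := rfl
  have w2 : Ideal.Quotient.mk (grassIdeal 3 m) (wX m 2) = sw 3 m 1 := rfl
  have w3 : Ideal.Quotient.mk (grassIdeal 3 m) (wX m 3) = sw 3 m 2 := rfl
  have h0 : Ideal.Quotient.mk (grassIdeal 3 m) (hX m 0) = 1 := by simp [hX]
  have r1 := hrel 1 (by norm_num)
  have r2 := hrel 2 (by norm_num)
  simp only [Finset.sum_range_succ, Finset.sum_range_zero, map_add, map_mul, w0, map_one,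
    map_zero] at r1 r2
  norm_num [w1, w2, w3, h0] at r1 r2
  refine vanish h2 _ (sw 3 m 1) _ (fun j => Ideal.Quotient.mk (grassIdeal 3 m) (hX m j))
    (2 ^ s) s rfl (by omega) h0 ?_ ?_ ?_ ?_
  · show Ideal.Quotient.mk (grassIdeal 3 m) (hX m 1) = _
    linear_combination r1 - sw 3 m 0 * h2
  · show Ideal.Quotient.mk (grassIdeal 3 m) (hX m 2) = sw 3 m 0 *
      Ideal.Quotient.mk (grassIdeal 3 m) (hX m 1) + _
    linear_combination r2 - (sw 3 m 1 + sw 3 m 0 *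
      Ideal.Quotient.mk (grassIdeal 3 m) (hX m 1)) * h2
  · intro k
    have r := hrel (k + 3) (by omega)
    rw [Finset.sum_range_succ, Finset.sum_range_succ, Finset.sum_range_succ,
      Finset.sum_range_one, if_pos (by omega), if_pos (by omega), if_pos (by omega),
      if_pos (by omega), show k + 3 - 0 = k + 3 by omega, show k + 3 - 1 = k + 2 by omega,
      show k + 3 - 2 = k + 1 by omega, show k + 3 - 3 = k by omega] at r
    simp only [map_add, map_mul, w0, w1, w2, w3, map_one] at r
    show Ideal.Quotient.mk (grassIdeal 3 m) (hX m (k + 3)) =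
      sw 3 m 0 * Ideal.Quotient.mk (grassIdeal 3 m) (hX m (k + 2)) +
      sw 3 m 1 * Ideal.Quotient.mk (grassIdeal 3 m) (hX m (k + 1)) +
      sw 3 m 2 * Ideal.Quotient.mk (grassIdeal 3 m) (hX m k)
    linear_combination r - (sw 3 m 0 * Ideal.Quotient.mk (grassIdeal 3 m) (hX m (k + 2)) +
      sw 3 m 1 * Ideal.Quotient.mk (grassIdeal 3 m) (hX m (k + 1)) +
      sw 3 m 2 * Ideal.Quotient.mk (grassIdeal 3 m) (hX m k)) * h2
  · intro k hk
    show Ideal.Quotient.mk (grassIdeal 3 m) (hX m k) = 0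
    rw [hX_zero_of_lt m k (by omega), map_zero]

/-- Polynomial ring in the Stiefel-Whitney roots. -/
abbrev RX := MvPolynomial (Fin 3) (ZMod 2)

/-- Elementary symmetric polynomials. -/
def el : Fin 3 → RX
  | 0 => X 0 + X 1 + X 2
  | 1 => X 0 * X 1 + X 0 * X 2 + X 1 * X 2
  | 2 => X 0 * X 1 * X 2

/-- Complete symmetric polynomials, by recursion. -/
def hs : ℕ → RX
  | 0 => 1
  | 1 => el 0
  | 2 => el 0 * el 0 + el 1
  | (k + 3) => el 0 * hs (k + 2) + el 1 * hs (k + 1) + el 2 * hs k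

/-- Vandermonde product. -/
def del : RX := X 0 ^ 2 * (X 1 + X 2) + X 1 ^ 2 * (X 0 + X 2) + X 2 ^ 2 * (X 0 + X 1)

lemma two_RX : (2 : RX) = 0 := CharTwo.two_eq_zero

lemma hs_del (k : ℕ) : hs k * del =
    X 0 ^ (k + 2) * (X 1 + X 2) + X 1 ^ (k + 2) * (X 0 + X 2) + X 2 ^ (k + 2) * (X 0 + X 1) := by
  induction k using Nat.strong_induction_on with
  | _ k ih =>
    match k with
    | 0 => simp [hs, del]
    | 1 =>
      simp only [hs, del, el]
      linear_combination (X 0 ^ 2 * X 1 ^ 2 + X 0 ^ 2 * X 2 ^ 2 + X 1 ^ 2 * X 2 ^ 2 +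
        X 0 ^ 2 * X 1 * X 2 + X 0 * X 1 ^ 2 * X 2 + X 0 * X 1 * X 2 ^ 2) * two_RX
    | 2 =>
      simp only [hs, del, el]
      linear_combination (X 0 * X 1 * X 2 ^ 3 * 3 + X 0 * X 1 ^ 2 * X 2 ^ 2 * 4 +
        X 0 * X 1 ^ 3 * X 2 * 3 + X 0 ^ 2 * X 1 * X 2 ^ 2 * 4 + X 0 ^ 2 * X 1 ^ 2 * X 2 * 4 +
        X 0 ^ 2 * X 1 ^ 3 * 2 + X 0 ^ 2 * X 2 ^ 3 * 2 + X 0 ^ 3 * X 1 * X 2 * 3 +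
        X 0 ^ 3 * X 1 ^ 2 * 2 + X 0 ^ 3 * X 2 ^ 2 * 2 + X 1 ^ 2 * X 2 ^ 3 * 2 +
        X 1 ^ 3 * X 2 ^ 2 * 2) * two_RX
    | (k + 3) =>
      have i0 := ih k (by omega)
      have i1 := ih (k + 1) (by omega)
      have i2 := ih (k + 2) (by omega)
      have e : hs (k + 3) * del = el 0 * (hs (k + 2) * del) + el 1 * (hs (k + 1) * del)
        + el 2 * (hs k * del) := by
        rw [hs]; ring
      have c : ∀ x : RX, x = X 0 ∨ x = X 1 ∨ x = X 2 →
          x ^ 3 = el 0 * x ^ 2 + el 1 * x + el 2 := by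
        rintro x (rfl | rfl | rfl) <;> simp only [el]
        · linear_combination (-(X 0 ^ 2 * X 1 + X 0 ^ 2 * X 2 + X 0 * X 1 * X 2) : RX) * two_RX
        · linear_combination (-(X 1 ^ 2 * X 0 + X 1 ^ 2 * X 2 + X 0 * X 1 * X 2) : RX) * two_RX
        · linear_combination (-(X 2 ^ 2 * X 0 + X 2 ^ 2 * X 1 + X 0 * X 1 * X 2) : RX) * two_RX
      have c0 := c (X 0) (by simp)
      have c1 := c (X 1) (by simp)
      have c2 := c (X 2) (by simp)
      rw [e, i0, i1, i2]
      linear_combination (-(X 0 ^ (k + 2) * (X 1 + X 2))) * c0 -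
        (X 1 ^ (k + 2) * (X 0 + X 2)) * c1 - (X 2 ^ (k + 2) * (X 0 + X 1)) * c2

/-- The ideal generated by the `n`-th powers of the variables. -/
def JX (n : ℕ) : Ideal RX :=
  Ideal.span ((fun t => monomial t (1 : ZMod 2)) '' Set.range (fun i : Fin 3 => Finsupp.single i n))

lemma X_pow_mem_s4 (n k : ℕ) (i : Fin 3) (h : n ≤ k) : (X i ^ k : RX) ∈ JX n := by
  obtain ⟨l, rfl⟩ := Nat.exists_eq_add_of_le h
  rw [pow_add]
  apply Ideal.mul_mem_right
  apply Ideal.subset_span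
  exact ⟨Finsupp.single i n, ⟨i, rfl⟩, by simp [X_pow_eq_monomial]⟩

lemma coeff_zero_of_mem (n : ℕ) (p : RX) (hp : p ∈ JX n) (t : Fin 3 →₀ ℕ) (ht : ∀ i, t i < n) :
    coeff t p = 0 := by
  by_contra h
  obtain ⟨u, ⟨i, rfl⟩, hu⟩ := mem_ideal_span_monomial_image.1 hp t (mem_support_iff.2 h)
  have := hu i
  simp at this
  have := ht i
  omega

/-- The colon ideal of `JX n` by `del`. -/
def KX (n : ℕ) : Ideal RX where
  carrier := { p | p * del ∈ JX n }
  add_mem' := by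
    intro a b ha hb
    simp only [Set.mem_ofPred_eq] at *
    rw [add_mul]
    exact Ideal.add_mem _ ha hb
  zero_mem' := by simp
  smul_mem' := by
    intro c x hx
    simp only [Set.mem_ofPred_eq, smul_eq_mul] at *
    rw [mul_assoc]
    exact Ideal.mul_mem_left _ _ hx

lemma mem_KX (n : ℕ) (p : RX) : p ∈ KX n ↔ p * del ∈ JX n := Iff.rfl

lemma hs_mem (m k : ℕ) (h : m < k) : hs k ∈ KX (m + 3) := by
  rw [mem_KX, hs_del]
  refine Ideal.add_mem _ (Ideal.add_mem _ ?_ ?_) ?_ <;>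
  exact Ideal.mul_mem_right _ _ (X_pow_mem_s4 _ _ _ (by omega))

/-- The map from the free polynomial ring. -/
def psi (m : ℕ) : MvPolynomial (Fin 3 ⊕ Fin m) (ZMod 2) →ₐ[ZMod 2] (RX ⧸ KX (m + 3)) :=
  aeval (Sum.elim (fun i => Ideal.Quotient.mk _ (el i))
    (fun j => Ideal.Quotient.mk _ (hs ((j : ℕ) + 1))))

lemma psi_hX (m j : ℕ) : psi m (hX m j) = Ideal.Quotient.mk _ (hs j) := by
  unfold hX
  split_ifs with h1 h2
  · subst h1; simp [hs]
  · simp only [psi, aeval_X, Sum.elim_inr]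
    rw [show j - 1 + 1 = j by omega]
  · rw [map_zero, eq_comm, Ideal.Quotient.eq_zero_iff_mem]
    exact hs_mem m j (by omega)

lemma psi_inl (m : ℕ) (i : Fin 3) : psi m (X (Sum.inl i)) = Ideal.Quotient.mk _ (el i) := by
  simp [psi]

lemma psi_ideal (m : ℕ) (p) (hp : p ∈ grassIdeal 3 m) : psi m p = 0 := by
  have : grassIdeal 3 m ≤ RingHom.ker (psi m) := by
    rw [grassIdeal, Ideal.span_le]
    rintro p ⟨d, hd, rfl⟩
    rw [comp_eq m d hd]
    simp only [SetLike.mem_coe, RingHom.mem_ker]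
    have w0 : psi m (wX m 0) = 1 := by simp [wX]
    have w1 : psi m (wX m 1) = Ideal.Quotient.mk _ (el 0) := psi_inl m 0
    have w2 : psi m (wX m 2) = Ideal.Quotient.mk _ (el 1) := psi_inl m 1
    have w3 : psi m (wX m 3) = Ideal.Quotient.mk _ (el 2) := psi_inl m 2
    rw [Finset.sum_range_succ, Finset.sum_range_succ, Finset.sum_range_succ,
      Finset.sum_range_one]
    match d with
    | 0 => omega
    | 1 =>
      norm_num [w0, w1, w2, w3, psi_hX]
      rw [← map_mul, ← map_add]
      convert map_zero (Ideal.Quotient.mk (KX (m + 3))) using 2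
      simp only [hs]
      linear_combination el 0 * two_RX
    | 2 =>
      norm_num [w0, w1, w2, w3, psi_hX]
      simp only [← map_mul, ← map_add]
      convert map_zero (Ideal.Quotient.mk (KX (m + 3))) using 2
      simp only [hs]
      linear_combination (el 0 * el 0 + el 1) * two_RX
    | (k + 3) =>
      rw [if_pos (by omega), if_pos (by omega), if_pos (by omega),
        if_pos (by omega), show k + 3 - 0 = k + 3 by omega, show k + 3 - 1 = k + 2 by omega,
        show k + 3 - 2 = k + 1 by omega, show k + 3 - 3 = k by omega]
      simp only [map_add, map_mul, w0, w1, w2, w3, psi_hX, one_mul]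
      simp only [← map_mul, ← map_add]
      convert map_zero (Ideal.Quotient.mk (KX (m + 3))) using 2
      rw [hs]
      linear_combination (el 0 * hs (k + 2) + el 1 * hs (k + 1) + el 2 * hs k) * two_RX
  exact this hp

/-- Monomials in three variables. -/
def mon (a b c : ℕ) : RX := X 0 ^ a * X 1 ^ b * X 2 ^ c

lemma mon_mul (a b c a' b' c' : ℕ) : mon a b c * mon a' b' c' = mon (a + a') (b + b') (c + c') := by
  unfold mon; ring

/-- Exponent vector. -/
def ex (a b c : ℕ) : Fin 3 →₀ ℕ := Finsupp.single 0 a + Finsupp.single 1 b + Finsupp.single 2 c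

lemma ex0 (a b c : ℕ) : ex a b c 0 = a := by simp [ex]
lemma ex1 (a b c : ℕ) : ex a b c 1 = b := by simp [ex]
lemma ex2 (a b c : ℕ) : ex a b c 2 = c := by simp [ex]

lemma coeff_mon (a b c a' b' c' : ℕ) :
    coeff (ex a' b' c') (mon a b c) = if a = a' ∧ b = b' ∧ c = c' then 1 else 0 := by
  have : mon a b c = monomial (ex a b c) 1 := by
    simp [mon, ex, X_pow_eq_monomial, monomial_mul]
  rw [this, coeff_monomial]
  congr 1
  apply propext
  constructor
  · intro h
    exact ⟨by rw [← ex0 a b c, h, ex0], by rw [← ex1 a b c, h, ex1], by rw [← ex2 a b c, h, ex2]⟩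
  · rintro ⟨rfl, rfl, rfl⟩; rfl

lemma nonvanish_poly (t r q : ℕ) (hr : r = 2 ^ t) (hq : q = 2 ^ (t + 1)) (hr4 : 4 ≤ r) :
    el 0 ^ q * el 1 ^ r * el 2 ∉ KX (q + 2) := by
  have hqr : q = 2 * r := by rw [hq, hr]; ring
  intro h
  rw [mem_KX] at h
  have := coeff_zero_of_mem _ _ h (ex (q + 1) (r + 3) (r + 2)) (by
    intro i
    fin_cases i
    · show ex _ _ _ 0 < _; rw [ex0]; omega
    · show ex _ _ _ 1 < _; rw [ex1]; omega
    · show ex _ _ _ 2 < _; rw [ex2]; omega)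
  have e0 : el 0 ^ q = mon q 0 0 + mon 0 q 0 + mon 0 0 q := by
    simp only [el, mon]
    rw [hq, add_pow_char_pow, add_pow_char_pow]
    ring
  have e1 : el 1 ^ r = mon r r 0 + mon r 0 r + mon 0 r r := by
    simp only [el, mon]
    rw [hr, add_pow_char_pow, add_pow_char_pow]
    ring
  have e2 : el 2 * del = mon 3 2 1 + mon 3 1 2 + mon 2 3 1 + mon 1 3 2 + mon 2 1 3 + mon 1 2 3 := by
    simp only [el, del, mon]
    ring
  rw [mul_assoc, e0, e1, e2] at this
  simp only [add_mul, mul_add, mon_mul, coeff_add, coeff_mon] at this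
  have n1 : ∀ (p : Prop) [Decidable p], ¬ p → (if p then (1 : ZMod 2) else 0) = 0 :=
    fun p _ h => if_neg h
  simp (disch := omega) only [n1] at this
  simp at this

/-- For `s ≥ 3`, `n = 2^s + 2`: in `A(3,n)` the product `w_1^{2^s} · w_2^{2^{s-1}} · w_3`
is nonzero, while `w_1^{2^s} · w_2^{2^{s-1}} · w_3^2` is zero. -/
theorem g3n_case2 (s : ℕ) (hs : 3 ≤ s) (n : ℕ) (hn : n = 2 ^ s + 2) :
    sw 3 (n - 3) 0 ^ (2 ^ s) * sw 3 (n - 3) 1 ^ (2 ^ (s - 1)) * sw 3 (n - 3) 2 ≠ 0 ∧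
    sw 3 (n - 3) 0 ^ (2 ^ s) * sw 3 (n - 3) 1 ^ (2 ^ (s - 1)) * sw 3 (n - 3) 2 ^ 2 = 0 := by
  subst hn
  obtain ⟨t, rfl⟩ : ∃ t, s = t + 1 := ⟨s - 1, by omega⟩
  have h8 : 2 ^ 3 ≤ 2 ^ (t + 1) := Nat.pow_le_pow_right (by norm_num) hs
  have h4 : 2 ^ 2 ≤ 2 ^ t := Nat.pow_le_pow_right (by norm_num) (by omega)
  obtain ⟨m, hm⟩ : ∃ m, m + 1 = 2 ^ (t + 1) := ⟨2 ^ (t + 1) - 1, by omega⟩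
  rw [show 2 ^ (t + 1) + 2 - 3 = m by omega, Nat.add_sub_cancel]
  constructor
  · intro h
    simp only [sw, ← map_pow, ← map_mul] at h
    rw [Ideal.Quotient.eq_zero_iff_mem] at h
    have h' := psi_ideal m _ h
    simp only [map_mul, map_pow, psi_inl] at h'
    simp only [← map_pow, ← map_mul] at h'
    rw [Ideal.Quotient.eq_zero_iff_mem, show m + 3 = 2 ^ (t + 1) + 2 by omega] at h'
    exact nonvanish_poly t _ _ rfl rfl (by omega) h'
  · have := vanish_coh (t + 1) m hs hm
    linear_combination sw 3 m 1 ^ (2 ^ t) * this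
end
end

section
/- Let s ≥ 2 and t be integers with 3 ≤ t ≤ 2^s, and put n = 2^s + t. Then the product w_1^{2^s} · w_2^{2^s} · w_3^{t−3} is a nonzero element of A(3,n); it lies in the top degree 3(2^s + t − 3), which equals the dimension of G_3(ℝ^n). -/
open MvPolynomial TensorProduct

noncomputable section

namespace G3

/-- Polynomial ring of Chern roots. -/
abbrev P := MvPolynomial (Fin 3) (ZMod 2)

lemma coeff_graded {σ R : Type*} [CommRing R] [Algebra (ZMod 2) R] (w : σ → ℕ) (v : σ → R) (d : ℕ)
    (p : MvPolynomial σ (ZMod 2)) :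
    (aeval (fun i => Polynomial.C (v i) * Polynomial.X ^ (w i)) p : Polynomial R).coeff d
      = aeval v (weightedHomogeneousComponent w d p) := by
  classical
  induction p using MvPolynomial.induction_on' with
  | monomial e c =>
    have h1 : (aeval (fun i => Polynomial.C (v i) * Polynomial.X ^ (w i)) (monomial e c) :
        Polynomial R) = Polynomial.C (aeval v (monomial e c)) *
          Polynomial.X ^ (Finsupp.weight w e) := by
      rw [aeval_monomial, aeval_monomial, Finsupp.weight_apply, Polynomial.algebraMap_apply]
      simp only [Finsupp.prod, Finsupp.sum, mul_pow, Finset.prod_mul_distrib, map_mul, map_prod,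
        map_pow, ← pow_mul, Finset.prod_pow_eq_pow_sum, smul_eq_mul, mul_assoc]
      simp only [mul_comm]
    rw [h1, Polynomial.coeff_C_mul_X_pow]
    have h2 : IsWeightedHomogeneous w (monomial e c) (Finsupp.weight w e) :=
      isWeightedHomogeneous_monomial w e c rfl
    split_ifs with h
    · rw [h, h2.weightedHomogeneousComponent_same]
    · rw [h2.weightedHomogeneousComponent_ne _ h, map_zero]
  | add p q hp hq => simp only [map_add, Polynomial.coeff_add, hp, hq]

def x : P := X 0
def y : P := X 1
def z : P := X 2
def e1 : P := x + y + z
def e2 : P := x * y + y * z + x * z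
def e3 : P := x * y * z
def Δ : P := (x + y) * (y + z) * (x + z)

/-- complete homogeneous polynomials mod 2 -/
def h : ℕ → P
  | 0 => 1
  | 1 => e1
  | 2 => e1 * e1 + e2
  | (j + 3) => e1 * h (j + 2) + e2 * h (j + 1) + e3 * h j

lemma two_zero : (2 : P) = 0 := CharTwo.two_eq_zero

lemma h_rec (j : ℕ) : h (j + 3) = e1 * h (j + 2) + e2 * h (j + 1) + e3 * h j := by rw [h]

lemma delta_h (j : ℕ) :
    Δ * h j = x ^ (j + 2) * (y + z) + y ^ (j + 2) * (x + z) + z ^ (j + 2) * (x + y) := by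
  have t := two_zero
  induction j using Nat.strong_induction_on with
  | _ j ih =>
    match j with
    | 0 => simp only [h, Δ]; linear_combination (x * y * z) * t
    | 1 => simp only [h, Δ, e1]; grind
    | 2 => simp only [h, Δ, e1, e2]; grind
    | j + 3 =>
      have a := ih j (by omega)
      have b := ih (j + 1) (by omega)
      have c := ih (j + 2) (by omega)
      rw [h_rec]
      have : Δ * (e1 * h (j + 2) + e2 * h (j + 1) + e3 * h j)
        = e1 * (Δ * h (j + 2)) + e2 * (Δ * h (j + 1)) + e3 * (Δ * h j) := by ring
      rw [this, a, b, c]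
      simp only [e1, e2, e3, pow_succ, pow_add]
      generalize x ^ j = u
      generalize y ^ j = u'
      generalize z ^ j = u''
      grind

/-- the ideal (x^n, y^n, z^n) -/
def K (n : ℕ) : Ideal P := Ideal.span {x ^ n, y ^ n, z ^ n}

lemma K_pow {n a : ℕ} (hna : n ≤ a) (f : P) :
    x ^ a * f ∈ K n ∧ y ^ a * f ∈ K n ∧ z ^ a * f ∈ K n := by
  refine ⟨?_, ?_, ?_⟩ <;> refine Ideal.mul_mem_right _ _ (Ideal.mem_of_dvd _ (pow_dvd_pow _ hna)
    (Ideal.subset_span (by simp)))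

/-- colon ideal -/
def J (n : ℕ) : Ideal P := Submodule.comap (LinearMap.mulLeft P Δ) (K n)

lemma mem_J {n : ℕ} {f : P} : f ∈ J n ↔ Δ * f ∈ K n := Iff.rfl

lemma h_mem_J {n j : ℕ} (hj : n ≤ j + 2) : h j ∈ J n := by
  rw [mem_J, delta_h]
  exact add_mem (add_mem (K_pow hj _).1 (K_pow hj _).2.1) (K_pow hj _).2.2

def v (m : ℕ) : Fin 3 ⊕ Fin m → P := Sum.elim ![e1, e2, e3] (fun j => h (j + 1))

/-- truncated -/
def H (m j : ℕ) : P := if j ≤ m then h j else 0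

lemma H_sub (m j : ℕ) : H m j - h j ∈ J (m + 3) := by
  unfold H
  split_ifs with hj
  · simp
  · rw [zero_sub]; exact neg_mem (h_mem_J (by omega))

lemma psi_rel (m : ℕ) :
    (aeval (fun i => Polynomial.C (v m i) * Polynomial.X ^ (grassWt 3 m i)) (grassRel 3 m) :
      Polynomial P) = (1 + Polynomial.C e1 * Polynomial.X + Polynomial.C e2 * Polynomial.X ^ 2
        + Polynomial.C e3 * Polynomial.X ^ 3) *
        (∑ j ∈ Finset.range (m + 1), Polynomial.C (h j) * Polynomial.X ^ j) - 1 := by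
  rw [Finset.sum_range_succ', Finset.sum_range]
  simp only [grassRel, map_sub, map_mul, map_add, map_one, map_sum, aeval_X, Fin.sum_univ_three,
    v, grassWt, Sum.elim_inl, Sum.elim_inr]
  simp [h]
  ring

lemma coeff_rel (m d : ℕ) (hd : 0 < d) :
    aeval (v m) (weightedHomogeneousComponent (grassWt 3 m) d (grassRel 3 m)) ∈ J (m + 3) := by
  rw [← coeff_graded, psi_rel]
  set S : Polynomial P := ∑ j ∈ Finset.range (m + 1), Polynomial.C (h j) * Polynomial.X ^ j with hS
  have hc : ∀ j, S.coeff j = H m j := by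
    intro j
    simp [hS, Polynomial.coeff_C_mul, Polynomial.coeff_X_pow, H]
  have t := two_zero
  have ex : (1 + Polynomial.C e1 * Polynomial.X + Polynomial.C e2 * Polynomial.X ^ 2
        + Polynomial.C e3 * Polynomial.X ^ 3) * S - 1 = S + Polynomial.C e1 * (S * Polynomial.X)
        + Polynomial.C e2 * (S * Polynomial.X ^ 2) + Polynomial.C e3 * (S * Polynomial.X ^ 3) - 1 := by
    ring
  rw [ex]
  simp only [Polynomial.coeff_add, Polynomial.coeff_sub, Polynomial.coeff_C_mul,
    Polynomial.coeff_mul_X_pow', Polynomial.coeff_one]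
  match d, hd with
  | 1, _ =>
    have := add_mem (H_sub m 1) (Ideal.mul_mem_left _ e1 (H_sub m 0))
    convert this using 1
    simp [hc, h, Polynomial.coeff_mul_X (n := 0)]
    grind
  | 2, _ =>
    have := add_mem (add_mem (H_sub m 2) (Ideal.mul_mem_left _ e1 (H_sub m 1)))
      (Ideal.mul_mem_left _ e2 (H_sub m 0))
    convert this using 1
    simp [hc, h, Polynomial.coeff_mul_X (n := 1)]
    grind
  | d + 3, _ =>
    have := add_mem (add_mem (add_mem (H_sub m (d + 3)) (Ideal.mul_mem_left _ e1 (H_sub m (d + 2))))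
      (Ideal.mul_mem_left _ e2 (H_sub m (d + 1)))) (Ideal.mul_mem_left _ e3 (H_sub m d))
    convert this using 1
    have hr := h_rec d
    rw [Polynomial.coeff_mul_X]
    simp [hc]
    grind

lemma ideal_le (m : ℕ) (p) (hp : p ∈ grassIdeal 3 m) : aeval (v m) p ∈ J (m + 3) := by
  have : grassIdeal 3 m ≤ (J (m + 3)).comap (aeval (v m) : _ →ₐ[ZMod 2] P) := by
    unfold grassIdeal
    rw [Ideal.span_le]
    rintro _ ⟨d, hd, rfl⟩
    exact coeff_rel m d hd
  exact this hp

lemma K_coeff {n : ℕ} {f : P} (hf : f ∈ K n) (e : Fin 3 →₀ ℕ) (he : ∀ i, e i < n) :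
    coeff e f = 0 := by
  have key : ∀ (i : Fin 3) (g : P), coeff e (g * X i ^ n) = 0 := by
    intro i g
    rw [X_pow_eq_monomial, coeff_mul_monomial', if_neg]
    intro hle
    have := hle i
    simp at this
    have := he i
    omega
  unfold K at hf
  rw [Ideal.mem_span_insert] at hf
  obtain ⟨a, f', hf', rfl⟩ := hf
  rw [Ideal.mem_span_insert] at hf'
  obtain ⟨b, f'', hf'', rfl⟩ := hf'
  rw [Ideal.mem_span_singleton'] at hf''
  obtain ⟨c, rfl⟩ := hf''
  simp only [coeff_add, x, y, z, key, add_zero]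

lemma frob (a b : P) (s : ℕ) : (a + b) ^ (2 ^ s) = a ^ (2 ^ s) + b ^ (2 ^ s) :=
  add_pow_char_pow a b 2 s

lemma not_mem (r : ℕ) : Δ * e3 ^ r ∉ K (r + 3) := by
  intro hf
  have e3r : e3 ^ r = monomial (Finsupp.single 0 r + Finsupp.single 1 r + Finsupp.single 2 r) 1 := by
    simp only [e3, x, y, z, mul_pow, X_pow_eq_monomial, monomial_mul, mul_one]
  have hD : Δ = monomial (Finsupp.single 0 2 + Finsupp.single 1 1) 1
      + monomial (Finsupp.single 0 2 + Finsupp.single 2 1) 1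
      + monomial (Finsupp.single 1 2 + Finsupp.single 0 1) 1
      + monomial (Finsupp.single 1 2 + Finsupp.single 2 1) 1
      + monomial (Finsupp.single 2 2 + Finsupp.single 0 1) 1
      + monomial (Finsupp.single 2 2 + Finsupp.single 1 1) 1 := by
    have hm : ∀ i j : Fin 3, (monomial (Finsupp.single i 2 + Finsupp.single j 1) 1 : P)
        = X i ^ 2 * X j := by
      intro i j
      rw [X_pow_eq_monomial, X, monomial_mul, mul_one]
    simp only [hm]
    have t := two_zero
    simp only [Δ, x, y, z]
    linear_combination (X 0 * X 1 * X 2 : P) * t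
  have := K_coeff hf ((Finsupp.single 0 2 + Finsupp.single 1 1) +
    (Finsupp.single 0 r + Finsupp.single 1 r + Finsupp.single 2 r)) (by
      intro i; fin_cases i <;> simp [Finsupp.single_apply] <;> omega)
  rw [e3r, coeff_mul_monomial, hD] at this
  simp [coeff_monomial, Finsupp.ext_iff, Fin.forall_fin_succ, Finsupp.single_apply] at this

lemma main_not_mem (s r : ℕ) (hs : 2 ≤ s) :
    e1 ^ (2 ^ s) * e2 ^ (2 ^ s) * e3 ^ r ∉ J (2 ^ s + r + 3) := by
  have hq : 4 ≤ 2 ^ s := by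
    calc 4 = 2 ^ 2 := rfl
      _ ≤ 2 ^ s := Nat.pow_le_pow_right (by norm_num) hs
  have t := two_zero
  rw [mem_J]
  intro hmem
  apply not_mem (2 ^ s + r)
  have ex : e1 ^ (2 ^ s) * e2 ^ (2 ^ s) = e3 ^ (2 ^ s) +
      (x ^ (2 ^ s + 2 ^ s) * (y ^ (2 ^ s) + z ^ (2 ^ s))
      + y ^ (2 ^ s + 2 ^ s) * (x ^ (2 ^ s) + z ^ (2 ^ s))
      + z ^ (2 ^ s + 2 ^ s) * (x ^ (2 ^ s) + y ^ (2 ^ s))) := by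
    simp only [e1, e2, e3, frob, mul_pow, pow_add]
    generalize x ^ (2 ^ s) = u
    generalize y ^ (2 ^ s) = u'
    generalize z ^ (2 ^ s) = u''
    linear_combination (u * u' * u'') * t
  generalize 2 ^ s = q at *
  have hr : q + r + 3 ≤ q + q + r := by omega
  have k1 := (K_pow hr (Δ * (y ^ q + z ^ q) * (y * z) ^ r)).1
  have k2 := (K_pow hr (Δ * (x ^ q + z ^ q) * (x * z) ^ r)).2.1
  have k3 := (K_pow hr (Δ * (x ^ q + y ^ q) * (x * y) ^ r)).2.2
  have := sub_mem hmem (add_mem (add_mem k1 k2) k3)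
  convert this using 1
  rw [ex]
  simp only [e3, mul_pow, pow_add]
  ring

end G3

/-- For `s ≥ 2` and `3 ≤ t ≤ 2^s`, `n = 2^s + t`: in `A(3,n)` the product
`w_1^{2^s} · w_2^{2^s} · w_3^{t-3}` is nonzero; it lies in the top degree
`3(2^s + t - 3)`, which equals the dimension `3(n-3)` of `G_3(ℝ^n)`. -/
theorem g3n_case3 (s t n : ℕ) (hs : 2 ≤ s) (ht3 : 3 ≤ t) (ht : t ≤ 2 ^ s)
    (hn : n = 2 ^ s + t) :
    sw 3 (n - 3) 0 ^ (2 ^ s) * sw 3 (n - 3) 1 ^ (2 ^ s) * sw 3 (n - 3) 2 ^ (t - 3) ≠ 0 ∧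
    IsWeightedHomogeneous (grassWt 3 (n - 3))
      ((X (Sum.inl 0) : MvPolynomial (Fin 3 ⊕ Fin (n - 3)) (ZMod 2)) ^ (2 ^ s)
        * X (Sum.inl 1) ^ (2 ^ s) * X (Sum.inl 2) ^ (t - 3))
      (3 * (2 ^ s + t - 3)) ∧
    3 * (2 ^ s + t - 3) = 3 * (n - 3) := by
  have hm : n - 3 = 2 ^ s + (t - 3) := by omega
  refine ⟨?_, ?_, by omega⟩
  · intro h0
    simp only [sw, ← map_pow, ← map_mul] at h0
    rw [Ideal.Quotient.eq_zero_iff_mem] at h0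
    have h1 := G3.ideal_le _ _ h0
    simp only [map_mul, map_pow, aeval_X, G3.v, Sum.elim_inl] at h1
    apply G3.main_not_mem s (t - 3) hs
    rw [hm] at h1
    exact h1
  · have key : ∀ i : Fin 3, IsWeightedHomogeneous (grassWt 3 (n - 3))
        (X (Sum.inl i) : MvPolynomial (Fin 3 ⊕ Fin (n - 3)) (ZMod 2)) ((i : ℕ) + 1) :=
      fun i => isWeightedHomogeneous_X _ _ _
    have := (((key 0).pow (2 ^ s)).mul ((key 1).pow (2 ^ s))).mul ((key 2).pow (t - 3))
    convert this using 1
    simp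
    omega
end
end

section
/- Let s ≥ 2 and k be integers with 3 ≤ k ≤ 2^s, and put n = 2^s + k. Then in A(k,n) one has the identity w_1^{2^s} · w_2^{2^s} = w_3^{2^s}, and this common element is nonzero. -/
open MvPolynomial TensorProduct

noncomputable section

/-- Homogenisation map recording weights with an extra variable. -/
def gPhi (k m : ℕ) : MvPolynomial (Fin k ⊕ Fin m) (ZMod 2) →ₐ[ZMod 2]
    Polynomial (MvPolynomial (Fin k ⊕ Fin m) (ZMod 2)) :=
  MvPolynomial.aeval (fun i => Polynomial.C (X i) * Polynomial.X ^ (grassWt k m i))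

lemma gPhi_monomial (k m : ℕ) (d : (Fin k ⊕ Fin m) →₀ ℕ) (r : ZMod 2) :
    gPhi k m (monomial d r) =
      Polynomial.C (monomial d r) * Polynomial.X ^ (Finsupp.weight (grassWt k m) d) := by
  have h1 : (monomial d r : MvPolynomial (Fin k ⊕ Fin m) (ZMod 2)) =
      C r * ∏ i ∈ d.support, X i ^ d i := by
    rw [MvPolynomial.monomial_eq]; rfl
  rw [gPhi, MvPolynomial.aeval_monomial, h1, Finsupp.weight_apply, Finsupp.sum, Finsupp.prod]
  simp only [mul_pow, Finset.prod_mul_distrib, map_mul, map_prod, map_pow, ← pow_mul,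
    Finset.prod_pow_eq_pow_sum, smul_eq_mul]
  rw [mul_assoc]
  have h2 : ∑ i ∈ d.support, grassWt k m i * d i = ∑ i ∈ d.support, d i * grassWt k m i :=
    Finset.sum_congr rfl fun i _ => mul_comm _ _
  rw [h2]
  rfl

lemma gPhi_coeff (k m d : ℕ) (p : MvPolynomial (Fin k ⊕ Fin m) (ZMod 2)) :
    (gPhi k m p).coeff d = weightedHomogeneousComponent (grassWt k m) d p := by
  induction p using MvPolynomial.induction_on' with
  | monomial u a =>
    rw [gPhi_monomial, Polynomial.coeff_C_mul, Polynomial.coeff_X_pow]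
    classical
    ext e
    rw [coeff_weightedHomogeneousComponent, coeff_monomial]
    split_ifs with h1 h2 h3 <;> simp_all [coeff_monomial]
    all_goals (try intro h; try subst h; try simp_all)
  | add p q hp hq => simp [hp, hq]

/-- Total class as a polynomial. -/
def gW (k : ℕ) {R : Type*} [CommRing R] (w : Fin k → R) : Polynomial R :=
  1 + ∑ i : Fin k, Polynomial.C (w i) * Polynomial.X ^ ((i : ℕ) + 1)

lemma gW_coeff_zero (k : ℕ) {R : Type*} [CommRing R] (w : Fin k → R) : (gW k w).coeff 0 = 1 := by
  simp [gW, Polynomial.finsetSum_coeff]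

lemma gW_coeff (k : ℕ) {R : Type*} [CommRing R] (w : Fin k → R) (i : Fin k) :
    (gW k w).coeff ((i : ℕ) + 1) = w i := by
  simp only [gW, Polynomial.coeff_add, Polynomial.finsetSum_coeff, Polynomial.coeff_C_mul,
    Polynomial.coeff_X_pow, Polynomial.coeff_one]
  simp [Fin.val_inj]

lemma gW_natDegree (k : ℕ) {R : Type*} [CommRing R] (w : Fin k → R) :
    (gW k w).natDegree ≤ k := by
  unfold gW
  refine Polynomial.natDegree_add_le_of_degree_le (by simp) ?_
  refine Polynomial.natDegree_sum_le_of_forall_le _ _ fun i _ => ?_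
  exact (Polynomial.natDegree_C_mul_X_pow_le _ _).trans i.2

lemma gW_eq (k : ℕ) {R : Type*} [CommRing R] (w : Fin k → R) (p : Polynomial R)
    (h0 : p.coeff 0 = 1) (hd : p.natDegree ≤ k) (hw : ∀ i : Fin k, p.coeff ((i : ℕ) + 1) = w i) :
    gW k w = p := by
  ext d
  rcases d with _ | d
  · rw [gW_coeff_zero, h0]
  · by_cases h : d < k
    · rw [gW_coeff k w ⟨d, h⟩, hw ⟨d, h⟩]
    · rw [Polynomial.coeff_eq_zero_of_natDegree_lt, Polynomial.coeff_eq_zero_of_natDegree_lt]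
      · omega
      · have := gW_natDegree k w
        omega

lemma gW_map (k : ℕ) {R S : Type*} [CommRing R] [CommRing S] (f : R →+* S) (w : Fin k → R) :
    (gW k w).map f = gW k (fun i => f (w i)) := by
  simp [gW, Polynomial.map_sum]

lemma gPhi_rel (k m : ℕ) : gPhi k m (grassRel k m) =
    gW k (fun i => X (Sum.inl i)) * gW m (fun i => X (Sum.inr i)) - 1 := by
  simp [gPhi, grassRel, gW, grassWt]

lemma rel_map (k m : ℕ) {B : Type*} [CommRing B]
    (f : MvPolynomial (Fin k ⊕ Fin m) (ZMod 2) →+* B) (d : ℕ) :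
    f (weightedHomogeneousComponent (grassWt k m) d (grassRel k m)) =
    (gW k (fun i => f (X (Sum.inl i))) * gW m (fun i => f (X (Sum.inr i))) - 1).coeff d := by
  rw [← gPhi_coeff, gPhi_rel, ← Polynomial.coeff_map]
  simp [gW_map]

lemma coh_rel (k m : ℕ) : gW k (sw k m) *
    gW m (fun i => Ideal.Quotient.mk (grassIdeal k m) (X (Sum.inr i))) = 1 := by
  rw [← sub_eq_zero]
  ext d
  rcases Nat.eq_zero_or_pos d with rfl | hd
  · simp [Polynomial.mul_coeff_zero, gW_coeff_zero]
  · have := rel_map k m (Ideal.Quotient.mk (grassIdeal k m)) d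
    have hmem : weightedHomogeneousComponent (grassWt k m) d (grassRel k m) ∈ grassIdeal k m :=
      Ideal.subset_span ⟨d, hd, rfl⟩
    rw [Ideal.Quotient.eq_zero_iff_mem.mpr hmem] at this
    rw [Polynomial.coeff_zero]
    exact this.symm

lemma ideal_le (k m : ℕ) {B : Type*} [CommRing B]
    (f : MvPolynomial (Fin k ⊕ Fin m) (ZMod 2) →+* B)
    (h : gW k (fun i => f (X (Sum.inl i))) * gW m (fun i => f (X (Sum.inr i))) = 1) :
    grassIdeal k m ≤ RingHom.ker f := by
  unfold grassIdeal
  rw [Ideal.span_le]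
  rintro p ⟨d, hd, rfl⟩
  rw [SetLike.mem_coe, RingHom.mem_ker, rel_map, h]
  simp

open Polynomial in
lemma abstract_identity {A : Type*} [CommRing A] [CharP A 2] (W V : A[X]) (k s : ℕ)
    (hk : k ≤ 2 ^ s) (hWV : W * V = 1) (hW : W.natDegree ≤ k) (hV : V.natDegree ≤ 2 ^ s)
    (h0 : W.coeff 0 = 1) (hk3 : 3 ≤ k) :
    W.coeff 1 ^ 2 ^ s * W.coeff 2 ^ 2 ^ s = W.coeff 3 ^ 2 ^ s := by
  have two : (2 : A) = 0 := CharTwo.two_eq_zero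
  have twoP : (2 : A[X]) = 0 := CharTwo.two_eq_zero
  set P : A[X] := Polynomial.X * derivative W * V with hP
  have hPW : P * W = Polynomial.X * derivative W := by
    rw [hP]; linear_combination (Polynomial.X * derivative W) * hWV
  -- the second derivative of W vanishes in characteristic two
  have hdd : derivative (derivative W) = 0 := by
    ext d
    rw [coeff_derivative, coeff_derivative, Polynomial.coeff_zero]
    have : ((d + 1 : ℕ) + 1 : A) * ((d : A) + 1) = 0 := by
      have h : Even ((d + 1 + 1) * (d + 1)) := by
        rw [mul_comm]; exact Nat.even_mul_succ_self (d + 1)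
      obtain ⟨c, hc⟩ := h
      have : (((d + 1 + 1) * (d + 1) : ℕ) : A) = 0 := by
        rw [hc]; push_cast; linear_combination (c : A) * two
      exact_mod_cast this
    push_cast at this ⊢
    linear_combination (W.coeff (d + 1 + 1)) * this
  have hric : P ^ 2 = P + Polynomial.X * derivative P := by
    have h1 : derivative P * W + P * derivative W = derivative W := by
      rw [← derivative_mul, hPW, derivative_mul, hdd]; simp
    have h2 : (P ^ 2 - P - Polynomial.X * derivative P) * W = 0 := by
      have : (P ^ 2 - P - Polynomial.X * derivative P) * W
          = 2 * (P * (Polynomial.X * derivative W) - Polynomial.X * derivative W) := by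
        linear_combination (P - 1) * hPW - Polynomial.X * h1
      rw [this, twoP, zero_mul]
    have h3 : P ^ 2 - P - Polynomial.X * derivative P = 0 := by
      linear_combination V * h2 - (P ^ 2 - P - Polynomial.X * derivative P) * hWV
    linear_combination h3
  have hdouble : ∀ j, P.coeff (2 * j) = P.coeff j ^ 2 := by
    intro j
    have h1 : (P ^ 2).coeff (2 * j) = P.coeff j ^ 2 := by
      have := Polynomial.map_frobenius_expand (R := A) (p := 2) (f := P)
      rw [← this, mul_comm 2 j, Polynomial.coeff_map, coeff_expand_mul (by norm_num)]
      rfl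
    rw [← h1, hric, Polynomial.coeff_add]
    have : (Polynomial.X * derivative P).coeff (2 * j) = 0 := by
      rcases j with _ | j
      · simp
      · rw [show 2 * (j + 1) = (2 * j + 1) + 1 by ring, Polynomial.coeff_X_mul, coeff_derivative]
        push_cast
        linear_combination (P.coeff (2 * j + 1 + 1)) * ((j : A) + 1) * two
    rw [this, add_zero]
  have hpow : ∀ r j, P.coeff (2 ^ r * j) = P.coeff j ^ 2 ^ r := by
    intro r j
    induction r with
    | zero => simp
    | succ r ih => rw [pow_succ', mul_assoc, hdouble, ih, ← pow_mul, mul_comm]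
  have hlast : W.coeff k * V.coeff (2 ^ s) = 0 := by
    rw [← coeff_mul_add_eq_of_natDegree_le hW hV, hWV, Polynomial.coeff_one, if_neg (by omega)]
  have hXW : (Polynomial.X * derivative W).natDegree ≤ k := by
    rw [natDegree_le_iff_coeff_eq_zero]
    intro j hj
    rcases j with _ | j
    · simp
    · rw [Polynomial.coeff_X_mul, coeff_derivative, coeff_eq_zero_of_natDegree_lt (by omega), zero_mul]
  have hvan : ∀ j, k + 2 ^ s ≤ j → P.coeff j = 0 := by
    intro j hj
    rcases hj.eq_or_lt with rfl | hj
    · rw [hP, coeff_mul_add_eq_of_natDegree_le hXW hV]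
      obtain ⟨k, rfl⟩ : ∃ l, k = l + 1 := ⟨k - 1, by omega⟩
      rw [Polynomial.coeff_X_mul, coeff_derivative]
      linear_combination ((k : A) + 1) * hlast
    · refine coeff_eq_zero_of_natDegree_lt (lt_of_le_of_lt ?_ hj)
      exact (natDegree_mul_le).trans (by omega)
  have e1 : P.coeff 1 = W.coeff 1 := by
    have := congrArg (fun p => Polynomial.coeff p 1) hPW
    have hc0 : P.coeff 0 = 0 := by rw [hP, mul_assoc]; simp
    rw [show (1 : ℕ) = 0 + 1 by rfl, Polynomial.coeff_X_mul, coeff_derivative, Polynomial.coeff_mul,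
      Finset.Nat.sum_antidiagonal_eq_sum_range_succ_mk] at this
    simp only [Finset.sum_range_succ, Finset.sum_range_zero] at this
    norm_num [h0, hc0] at this
    exact this
  have e2 : P.coeff 2 = W.coeff 1 ^ 2 := by rw [← e1]; exact hdouble 1
  have e3 : P.coeff 3 = W.coeff 1 ^ 3 + W.coeff 1 * W.coeff 2 + W.coeff 3 := by
    have := congrArg (fun p => Polynomial.coeff p 3) hPW
    have hc0 : P.coeff 0 = 0 := by rw [hP, mul_assoc]; simp
    rw [show (3 : ℕ) = 2 + 1 by rfl, Polynomial.coeff_X_mul, coeff_derivative, Polynomial.coeff_mul,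
      Finset.Nat.sum_antidiagonal_eq_sum_range_succ_mk] at this
    simp only [Finset.sum_range_succ, Finset.sum_range_zero] at this
    norm_num [h0, hc0, e1, e2] at this
    linear_combination this + (W.coeff 3 - W.coeff 1 ^ 3 - W.coeff 1 * W.coeff 2) * two
  have f1 : W.coeff 1 ^ (2 * 2 ^ s) = 0 := by
    have := hpow (s + 1) 1
    rw [e1, mul_one, hvan _ (by rw [pow_succ]; omega), pow_succ'] at this
    exact this.symm
  have f3 := hpow s 3
  rw [hvan _ (by omega), e3, add_pow_char_pow, add_pow_char_pow, mul_pow, ← pow_mul,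
    show 3 * 2 ^ s = 2 * 2 ^ s + 2 ^ s by ring, pow_add, f1] at f3
  linear_combination - f3 - (W.coeff 3 ^ 2 ^ s) * two

open Polynomial in
lemma split_step {R : Type} [CommRing R] [Nontrivial R] (q : R[X]) (d : ℕ) (hq : q.Monic)
    (hd : q.natDegree = d + 1) :
    ∃ (S : Type) (_ : CommRing S) (_ : Nontrivial S) (f : R →+* S) (x : S) (q' : S[X]), q'.Monic ∧
      q'.natDegree = d ∧ q.map f = (Polynomial.X - Polynomial.C x) * q' ∧
      ∀ (c : R) (j : ℕ), j ≤ d → f c * x ^ j = 0 → c = 0 := by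
  have hroot : (q.map (AdjoinRoot.of q)).IsRoot (AdjoinRoot.root q) := AdjoinRoot.isRoot_root q
  obtain ⟨q', hq'⟩ := dvd_iff_isRoot.mpr hroot
  have inj : ∀ (c : R) (j : ℕ), j ≤ d →
      AdjoinRoot.of q c * AdjoinRoot.root q ^ j = 0 → c = 0 := by
    intro c j hj h
    have h2 : AdjoinRoot.mk q (Polynomial.C c * Polynomial.X ^ j) = 0 := by
      rw [map_mul, map_pow, AdjoinRoot.mk_C, AdjoinRoot.mk_X]; exact h
    rw [AdjoinRoot.mk_eq_zero] at h2
    by_contra hc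
    have h3 : (Polynomial.C c * Polynomial.X ^ j).degree < q.degree := by
      refine (degree_C_mul_X_pow_le _ _).trans_lt ?_
      rw [degree_eq_natDegree hq.ne_zero, hd]
      exact_mod_cast Nat.lt_succ_of_le hj
    have h4 := hq.not_dvd_of_degree_lt (fun h => hc (by
      have := congrArg (fun p => Polynomial.coeff p j) h
      simpa using this)) h3
    exact h4 h2
  have : Nontrivial (AdjoinRoot q) := by
    refine ⟨⟨1, 0, fun h => ?_⟩⟩
    exact one_ne_zero (inj 1 0 (Nat.zero_le _) (by simpa using h))
  have hm : q'.Monic := by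
    refine Monic.of_mul_monic_left (monic_X_sub_C (AdjoinRoot.root q)) ?_
    rw [← hq']; exact hq.map _
  refine ⟨AdjoinRoot q, inferInstance, inferInstance, AdjoinRoot.of q, AdjoinRoot.root q, q', hm, ?_, hq', inj⟩
  have h5 := congrArg natDegree hq'
  rw [hq.natDegree_map, hd, (monic_X_sub_C _).natDegree_mul hm, natDegree_X_sub_C] at h5
  omega

open Polynomial in
lemma exists_split (N : ℕ) : ∃ (S : Type) (_ : CommRing S) (_ : ZMod 2 →+* S) (W V : S[X]),
    W * V = 1 ∧ W.natDegree ≤ 3 ∧ V.natDegree ≤ N ∧ W.coeff 0 = 1 ∧ V.coeff 0 = 1 ∧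
    W.coeff 3 ^ N ≠ 0 := by
  obtain ⟨S₁, _, _, f₁, x₁, q₁, m₁, d₁, e₁, i₁⟩ := split_step (Polynomial.X ^ (N + 3) : (ZMod 2)[X])
    (N + 2) (monic_X_pow _) (natDegree_X_pow _)
  obtain ⟨S₂, _, _, f₂, x₂, q₂, m₂, d₂, e₂, i₂⟩ := split_step q₁ (N + 1) m₁ d₁
  obtain ⟨S₃, _, _, f₃, x₃, q₃, m₃, d₃, e₃, i₃⟩ := split_step q₂ N m₂ d₂
  set a := f₃ (f₂ x₁)
  set b := f₃ x₂
  have hne : (a * b * x₃) ^ N ≠ 0 := by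
    intro h
    have h1 := i₃ (f₂ x₁ ^ N * x₂ ^ N) N le_rfl (by
      rw [map_mul, map_pow, map_pow, ← mul_pow, ← mul_pow]; exact h)
    have h2 := i₂ (x₁ ^ N) N (by omega) (by rw [map_pow]; exact h1)
    have h3 := i₁ 1 N (by omega) (by rw [map_one, one_mul]; exact h2)
    exact one_ne_zero h3
  have key : (Polynomial.X ^ (N + 3) : S₃[X]) =
      ((Polynomial.X - Polynomial.C a) * (Polynomial.X - Polynomial.C b) *
        (Polynomial.X - Polynomial.C x₃)) * q₃ := by
    have h1 := congrArg (Polynomial.map f₃) (congrArg (Polynomial.map f₂) e₁)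
    simp only [Polynomial.map_mul, Polynomial.map_sub, Polynomial.map_pow, Polynomial.map_X,
      Polynomial.map_C, e₂, e₃] at h1
    rw [h1]; ring
  set E := (Polynomial.X - Polynomial.C a) * (Polynomial.X - Polynomial.C b) *
        (Polynomial.X - Polynomial.C x₃) with hE
  have hEm : E.Monic := ((monic_X_sub_C a).mul (monic_X_sub_C b)).mul (monic_X_sub_C x₃)
  have hEd : E.natDegree = 3 := by
    rw [hE, ((monic_X_sub_C a).mul (monic_X_sub_C b)).natDegree_mul (monic_X_sub_C x₃),
      (monic_X_sub_C a).natDegree_mul (monic_X_sub_C b)]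
    simp
  have hE0 : E.coeff 0 = - (a * b * x₃) := by
    simp [hE, mul_coeff_zero]
  refine ⟨S₃, inferInstance, f₃.comp (f₂.comp f₁), reflect 3 E, reflect N q₃, ?_, ?_, ?_, ?_, ?_, ?_⟩
  · rw [← reflect_mul E q₃ hEd.le d₃.le, ← key, add_comm N 3, ← one_mul (Polynomial.X ^ (3 + N)), ← Polynomial.C_1, reflect_C_mul_X_pow]
    simp [revAt_le]
  · rw [natDegree_le_iff_coeff_eq_zero]
    intro j hj
    rw [coeff_reflect, revAt_eq_self_of_lt hj]
    exact coeff_eq_zero_of_natDegree_lt (by omega)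
  · rw [natDegree_le_iff_coeff_eq_zero]
    intro j hj
    rw [coeff_reflect, revAt_eq_self_of_lt hj]
    exact coeff_eq_zero_of_natDegree_lt (by omega)
  · rw [coeff_reflect, revAt_le (by omega), Nat.sub_zero, ← hEd]; exact hEm
  · rw [coeff_reflect, revAt_le (by omega), Nat.sub_zero, ← d₃]; exact m₃
  · rw [coeff_reflect, revAt_le le_rfl, Nat.sub_self, hE0]
    intro h
    rcases neg_pow (a * b * x₃) N ▸ h with h'
    apply hne
    have : (-1 : S₃) ^ N * ((-1) ^ N * (a * b * x₃) ^ N) = 0 := by rw [h', mul_zero]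
    rwa [← mul_assoc, ← mul_pow, neg_one_mul, neg_neg, one_pow, one_mul] at this

lemma sw_three_ne (k N : ℕ) (hk3 : 3 ≤ k) : sw k N ⟨2, by omega⟩ ^ N ≠ 0 := by
  obtain ⟨S, _, g, W, V, hWV, hW, hV, hW0, hV0, hne⟩ := exists_split N
  let f : MvPolynomial (Fin k ⊕ Fin N) (ZMod 2) →+* S := eval₂Hom g
    (Sum.elim (fun i => W.coeff ((i : ℕ) + 1)) (fun i => V.coeff ((i : ℕ) + 1)))
  have hf := ideal_le k N f (by
    rw [gW_eq k _ W hW0 (by omega) (by simp [f]), gW_eq N _ V hV0 hV (by simp [f]), hWV])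
  intro h
  rw [sw, ← map_pow, Ideal.Quotient.eq_zero_iff_mem] at h
  have h2 := hf h
  rw [RingHom.mem_ker, map_pow] at h2
  apply hne
  simpa [f] using h2

lemma sw_identity (k s : ℕ) (hk3 : 3 ≤ k) (hk : k ≤ 2 ^ s) :
    sw k (2 ^ s) ⟨0, by omega⟩ ^ 2 ^ s * sw k (2 ^ s) ⟨1, by omega⟩ ^ 2 ^ s =
      sw k (2 ^ s) ⟨2, by omega⟩ ^ 2 ^ s := by
  have : Nontrivial (GrassCoh k (2 ^ s)) := ⟨⟨_, _, sw_three_ne k (2 ^ s) hk3⟩⟩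
  have : CharP (GrassCoh k (2 ^ s)) 2 := charP_of_injective_algebraMap
    (algebraMap (ZMod 2) (GrassCoh k (2 ^ s))).injective 2
  have := abstract_identity _ _ k s hk (coh_rel k (2 ^ s)) (gW_natDegree _ _) (gW_natDegree _ _)
    (gW_coeff_zero _ _) hk3
  rw [← gW_coeff k (sw k (2 ^ s)) ⟨0, by omega⟩, ← gW_coeff k (sw k (2 ^ s)) ⟨1, by omega⟩,
    ← gW_coeff k (sw k (2 ^ s)) ⟨2, by omega⟩]
  exact this

/-- For `s ≥ 2` and `3 ≤ k ≤ 2^s`, `n = 2^s + k`: in `A(k,n)` one has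
`w_1^{2^s} · w_2^{2^s} = w_3^{2^s}`, and this common element is nonzero. -/
theorem gkn_identity (s k n : ℕ) (hs : 2 ≤ s) (hk3 : 3 ≤ k) (hk : k ≤ 2 ^ s)
    (hn : n = 2 ^ s + k) :
    sw k (n - k) ⟨0, by omega⟩ ^ (2 ^ s) * sw k (n - k) ⟨1, by omega⟩ ^ (2 ^ s) =
      sw k (n - k) ⟨2, by omega⟩ ^ (2 ^ s) ∧
    sw k (n - k) ⟨2, by omega⟩ ^ (2 ^ s) ≠ 0 := by
  have hm : n - k = 2 ^ s := by omega
  generalize n - k = m at hm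
  subst hm
  exact ⟨sw_identity k s hk3 hk, sw_three_ne k (2 ^ s) hk3⟩
end
end

section
/- Let s ≥ 2 and k be integers with 3 ≤ k ≤ 2^s, and put n = 2^s + k. Then the product w_1^{2^s} · w_2^{2^s} · w_3^{2^s} is zero in A(k,n). -/
open MvPolynomial TensorProduct

noncomputable section

theorem exists_split_ext (k : ℕ) : ∀ (R : Type) [CommRing R] [Nontrivial R] (P : Polynomial R),
    P.Monic → P.natDegree = k →
    ∃ (S : Type) (_ : CommRing S) (f : R →+* S) (t : Multiset S), Function.Injective f ∧
      Multiset.card t = k ∧ P.map f = (t.map (fun a => Polynomial.X - Polynomial.C a)).prod := by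
  induction k with
  | zero =>
    intro R _ _ P hP hd
    refine ⟨R, inferInstance, RingHom.id R, 0, Function.injective_id, rfl, ?_⟩
    simp [hP.natDegree_eq_zero.1 hd]
  | succ k ih =>
    intro R _ _ P hP hd
    have hinj : Function.Injective (AdjoinRoot.of P) := by
      rw [injective_iff_map_eq_zero]
      intro x hx
      have h1 : P ∣ Polynomial.C x := by
        rw [← AdjoinRoot.mk_eq_zero]; exact hx
      by_contra hne
      refine hP.not_dvd_of_natDegree_lt (by simpa using hne) ?_ h1
      simp [hd]
    have hnt : Nontrivial (AdjoinRoot P) := hinj.nontrivial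
    have hroot : (P.map (AdjoinRoot.of P)).IsRoot (AdjoinRoot.root P) :=
      AdjoinRoot.isRoot_root P
    obtain ⟨Q, hQ⟩ := Polynomial.dvd_iff_isRoot.2 hroot
    have hQm : Q.Monic := by
      refine (Polynomial.monic_X_sub_C (AdjoinRoot.root P)).of_mul_monic_left ?_
      rw [← hQ]; exact hP.map _
    have hQd : Q.natDegree = k := by
      have h2 := congrArg Polynomial.natDegree hQ
      rw [(Polynomial.monic_X_sub_C _).natDegree_mul hQm, hP.natDegree_map, hd,
        Polynomial.natDegree_X_sub_C] at h2
      omega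
    obtain ⟨S, iS, f, t, hf, hc, ht⟩ := ih (AdjoinRoot P) Q hQm hQd
    refine ⟨S, iS, f.comp (AdjoinRoot.of P), f (AdjoinRoot.root P) ::ₘ t, hf.comp hinj,
      by simp [hc], ?_⟩
    rw [← Polynomial.map_map, hQ]
    simp [ht]

theorem esymm_cons_succ' {R : Type} [CommRing R] (a : R) (t : Multiset R) (n : ℕ) :
    (a ::ₘ t).esymm (n + 1) = t.esymm (n + 1) + a * t.esymm n := by
  simp [Multiset.esymm, Multiset.powersetCard_cons, Multiset.sum_map_mul_left]

theorem esymm_zero' {R : Type} [CommRing R] (t : Multiset R) : t.esymm 0 = 1 := by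
  simp [Multiset.esymm]

theorem esymm_sq_zero {R : Type} [CommRing R] (t : Multiset R) (h : ∀ a ∈ t, a ^ 2 = 0) :
    t.esymm 1 ^ 2 = 2 * t.esymm 2 ∧ t.esymm 1 * t.esymm 2 = 3 * t.esymm 3 := by
  induction t using Multiset.induction_on with
  | empty => simp [Multiset.esymm, Multiset.powersetCard_zero_right]
  | cons a t ih =>
    obtain ⟨h1, h2⟩ := ih (fun b hb => h b (Multiset.mem_cons_of_mem hb))
    have ha := h a (Multiset.mem_cons_self a t)
    have e1 := esymm_cons_succ' a t 0
    have e2 := esymm_cons_succ' a t 1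
    have e3 := esymm_cons_succ' a t 2
    norm_num [esymm_zero'] at e1 e2 e3
    rw [e1, e2, e3]
    constructor
    · linear_combination h1 + ha
    · linear_combination h2 + a * h1 + t.esymm 1 * ha

theorem esymm_frob {R : Type} [CommRing R] [CharP R 2] (t : Multiset R) (s n : ℕ) :
    (t.map (fun a => a ^ 2 ^ s)).esymm n = t.esymm n ^ 2 ^ s := by
  have : Fact (Nat.Prime 2) := ⟨Nat.prime_two⟩
  induction t using Multiset.induction_on generalizing n with
  | empty =>
    cases n with
    | zero => simp [esymm_zero']
    | succ n => simp [Multiset.esymm, Multiset.powersetCard_zero_right]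
  | cons a t ih =>
    cases n with
    | zero => simp [esymm_zero']
    | succ n =>
      rw [Multiset.map_cons, esymm_cons_succ', esymm_cons_succ', ih, ih, add_pow_char_pow, mul_pow]

theorem core {R : Type} [CommRing R] [Nontrivial R] [CharP R 2] (s k : ℕ) (hk3 : 3 ≤ k)
    (hk : k ≤ 2 ^ s)
    (P Q : Polynomial R) (hP : P.Monic) (hd : P.natDegree = k)
    (hPQ : P * Q = Polynomial.X ^ (2 ^ s + k)) :
    P.coeff (k - 1) ^ 2 ^ s * P.coeff (k - 2) ^ 2 ^ s * P.coeff (k - 3) ^ 2 ^ s = 0 := by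
  obtain ⟨S, iS, f, t, hf, hc, ht⟩ := exists_split_ext k R P hP hd
  have : CharP S 2 := charP_of_injective_ringHom hf 2
  have hz : ∀ a ∈ t, (a ^ 2 ^ s) ^ 2 = 0 := by
    intro a ha
    have h1 : a ^ (2 ^ s + k) = 0 := by
      have h2 := congrArg (fun p => Polynomial.eval a (p.map f)) hPQ
      have h3 : Polynomial.eval a (P.map f) = 0 := by
        rw [ht]
        have : Polynomial.X - Polynomial.C a ∣
            (t.map (fun a => Polynomial.X - Polynomial.C a)).prod :=
          Multiset.dvd_prod (Multiset.mem_map_of_mem _ ha)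
        exact Polynomial.dvd_iff_isRoot.1 this
      simp only [Polynomial.map_mul, Polynomial.eval_mul, h3, zero_mul, Polynomial.map_pow,
        Polynomial.map_X, Polynomial.eval_pow, Polynomial.eval_X] at h2
      exact h2.symm
    rw [← pow_mul]
    exact pow_eq_zero_of_le (by omega) h1
  have hco : ∀ j ≤ k, f (P.coeff (k - j)) = t.esymm j := by
    intro j hj
    rw [← Polynomial.coeff_map, ht, Multiset.prod_X_sub_C_coeff _ (by omega), hc,
      show k - (k - j) = j by omega]
    have : (-1 : S) = 1 := by
      have := CharP.cast_eq_zero S 2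
      push_cast at this
      linear_combination -this
    rw [this]; simp
  apply hf
  rw [map_zero, map_mul, map_mul, map_pow, map_pow, map_pow, hco 1 (by omega), hco 2 (by omega),
    hco 3 (by omega)]
  simp only [← esymm_frob]
  obtain ⟨h1, h2⟩ := esymm_sq_zero (t.map (fun a => a ^ 2 ^ s)) (by simpa using hz)
  have h0 := CharP.cast_eq_zero S 2
  push_cast at h0
  generalize (t.map (fun a => a ^ 2 ^ s)).esymm 1 = e1 at *
  generalize (t.map (fun a => a ^ 2 ^ s)).esymm 2 = e2 at *
  generalize (t.map (fun a => a ^ 2 ^ s)).esymm 3 = e3 at *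
  linear_combination (-e1 * e2) * h2 + e2 ^ 2 * h1 + (e2 ^ 3 - e1 * e2 * e3) * h0

/-- The algebra map sending a variable to itself times `t` to its weight. -/
def gradMap (k m : ℕ) : MvPolynomial (Fin k ⊕ Fin m) (ZMod 2) →ₐ[ZMod 2]
    Polynomial (MvPolynomial (Fin k ⊕ Fin m) (ZMod 2)) :=
  MvPolynomial.aeval (fun i => Polynomial.C (X i) * Polynomial.X ^ grassWt k m i)

theorem gradMap_coeff (k m d : ℕ) (p : MvPolynomial (Fin k ⊕ Fin m) (ZMod 2)) :
    (gradMap k m p).coeff d = weightedHomogeneousComponent (grassWt k m) d p := by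
  induction p using MvPolynomial.induction_on' with
  | add p q hp hq => simp [hp, hq]
  | monomial e c =>
    have h1 : gradMap k m (monomial e c) =
        Polynomial.C (monomial e c) * Polynomial.X ^ (Finsupp.weight (grassWt k m) e) := by
      have h2 : (algebraMap (ZMod 2) (Polynomial (MvPolynomial (Fin k ⊕ Fin m) (ZMod 2)))) c
          = Polynomial.C (MvPolynomial.C c) := rfl
      have h3 : (e.prod fun i j => (Polynomial.C (X i : MvPolynomial (Fin k ⊕ Fin m) (ZMod 2)) *
          Polynomial.X ^ grassWt k m i) ^ j) = Polynomial.C (e.prod fun i j => X i ^ j) *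
          Polynomial.X ^ (Finsupp.weight (grassWt k m) e) := by
        rw [Finsupp.weight_apply, Finsupp.sum, Finsupp.prod, Finsupp.prod,
          ← Finset.prod_pow_eq_pow_sum, map_prod, ← Finset.prod_mul_distrib]
        refine Finset.prod_congr rfl fun i _ => ?_
        rw [mul_pow, ← pow_mul, Polynomial.C_pow, smul_eq_mul, mul_comm (grassWt k m i)]
      have h4 := MvPolynomial.monomial_eq (s := e) (a := c)
      rw [gradMap, MvPolynomial.aeval_monomial, h2, h3, h4, Polynomial.C_mul, mul_assoc]
    rw [h1, Polynomial.coeff_C_mul_X_pow]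
    by_cases hd : d = Finsupp.weight (grassWt k m) e
    · rw [if_pos hd]
      exact ((weightedHomogeneousComponent_of_mem
        (isWeightedHomogeneous_monomial _ _ _ hd.symm)).trans (by simp)).symm
    · rw [if_neg hd]
      exact ((weightedHomogeneousComponent_of_mem
        (isWeightedHomogeneous_monomial _ _ _ rfl)).trans (by simp [hd])).symm

/-- The total class as a polynomial in an auxiliary variable, over any ring. -/
def totPoly {R : Type} [CommRing R] (k : ℕ) (w : Fin k → R) : Polynomial R :=
  1 + ∑ i : Fin k, Polynomial.C (w i) * Polynomial.X ^ ((i : ℕ) + 1)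

theorem totPoly_natDegree {R : Type} [CommRing R] (k : ℕ) (w : Fin k → R) :
    (totPoly k w).natDegree ≤ k := by
  refine Polynomial.natDegree_add_le_of_degree_le (by simp) ?_
  refine Polynomial.natDegree_sum_le_of_forall_le _ _ fun i _ => ?_
  exact (Polynomial.natDegree_C_mul_X_pow_le _ _).trans (by omega)

theorem totPoly_coeff_zero {R : Type} [CommRing R] (k : ℕ) (w : Fin k → R) :
    (totPoly k w).coeff 0 = 1 := by
  simp [totPoly, Polynomial.finsetSum_coeff]

theorem totPoly_coeff {R : Type} [CommRing R] (k : ℕ) (w : Fin k → R) (i : Fin k) :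
    (totPoly k w).coeff ((i : ℕ) + 1) = w i := by
  simp only [totPoly, Polynomial.coeff_add, Polynomial.finsetSum_coeff,
    Polynomial.coeff_C_mul_X_pow, Polynomial.coeff_one]
  rw [Finset.sum_eq_single i]
  · simp
  · intro j _ hj
    rw [if_neg]
    intro h
    exact hj (Fin.ext (by omega))
  · simp

theorem tot_mul (k m : ℕ) :
    totPoly k (sw k m) *
      totPoly m (fun j => Ideal.Quotient.mk (grassIdeal k m) (X (Sum.inr j))) = 1 := by
  have h1 : (gradMap k m (grassRel k m)).map (Ideal.Quotient.mk (grassIdeal k m)) =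
      totPoly k (sw k m) *
      totPoly m (fun j => Ideal.Quotient.mk (grassIdeal k m) (X (Sum.inr j))) - 1 := by
    simp [gradMap, grassRel, totPoly, sw, grassWt, Polynomial.map_sum]
  rw [← sub_eq_zero, ← h1]
  ext d
  rcases Nat.eq_zero_or_pos d with rfl | hd
  · rw [h1, Polynomial.coeff_sub, Polynomial.mul_coeff_zero, totPoly_coeff_zero,
      totPoly_coeff_zero]
    simp
  · rw [Polynomial.coeff_map, gradMap_coeff, Polynomial.coeff_zero, Ideal.Quotient.eq_zero_iff_mem]
    exact Ideal.subset_span ⟨d, hd, rfl⟩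

theorem gkn_zero_aux (s k : ℕ) (hk3 : 3 ≤ k) (hk : k ≤ 2 ^ s) :
    sw k (2 ^ s) ⟨0, by omega⟩ ^ (2 ^ s) * sw k (2 ^ s) ⟨1, by omega⟩ ^ (2 ^ s) *
      sw k (2 ^ s) ⟨2, by omega⟩ ^ (2 ^ s) = 0 := by
  rcases subsingleton_or_nontrivial (GrassCoh k (2 ^ s)) with hR | hR
  · exact Subsingleton.elim _ _
  have : CharP (GrassCoh k (2 ^ s)) 2 :=
    charP_of_injective_ringHom (algebraMap (ZMod 2) (GrassCoh k (2 ^ s))).injective 2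
  have hW := totPoly_natDegree k (sw k (2 ^ s))
  have hV := totPoly_natDegree (2 ^ s)
    (fun j => Ideal.Quotient.mk (grassIdeal k (2 ^ s)) (X (Sum.inr j)))
  have hmul := Polynomial.reflect_mul _ _ hW hV
  rw [tot_mul] at hmul
  have hone : Polynomial.reflect (k + 2 ^ s) (1 : Polynomial (GrassCoh k (2 ^ s))) =
      Polynomial.X ^ (2 ^ s + k) := by
    rw [← Polynomial.C_1, Polynomial.reflect_C]; simp [add_comm]
  rw [hone] at hmul
  have hco : ∀ j ≤ k, (Polynomial.reflect k (totPoly k (sw k (2 ^ s)))).coeff (k - j) =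
      (totPoly k (sw k (2 ^ s))).coeff j := by
    intro j hj
    rw [Polynomial.coeff_reflect, Polynomial.revAt_le (by omega), show k - (k - j) = j by omega]
  have hck : (Polynomial.reflect k (totPoly k (sw k (2 ^ s)))).coeff k = 1 := by
    have := hco 0 (by omega)
    rwa [totPoly_coeff_zero] at this
  have hdeg : (Polynomial.reflect k (totPoly k (sw k (2 ^ s)))).natDegree ≤ k := by
    rw [Polynomial.natDegree_le_iff_coeff_eq_zero]
    intro N hN
    rw [Polynomial.coeff_reflect, Polynomial.revAt_eq_self_of_lt hN]
    exact Polynomial.coeff_eq_zero_of_natDegree_lt (by omega)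
  have hmon := Polynomial.monic_of_natDegree_le_of_coeff_eq_one k hdeg hck
  have hdk : (Polynomial.reflect k (totPoly k (sw k (2 ^ s)))).natDegree = k :=
    le_antisymm hdeg (Polynomial.le_natDegree_of_ne_zero (by rw [hck]; exact one_ne_zero))
  have := core s k hk3 hk _ _ hmon hdk hmul.symm
  rw [hco 1 (by omega), hco 2 (by omega), hco 3 (by omega)] at this
  have c1 := totPoly_coeff k (sw k (2 ^ s)) ⟨0, by omega⟩
  have c2 := totPoly_coeff k (sw k (2 ^ s)) ⟨1, by omega⟩
  have c3 := totPoly_coeff k (sw k (2 ^ s)) ⟨2, by omega⟩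
  rw [← c1, ← c2, ← c3]
  exact this

/-- For `s ≥ 2` and `3 ≤ k ≤ 2^s`, `n = 2^s + k`: in `A(k,n)` the product
`w_1^{2^s} · w_2^{2^s} · w_3^{2^s}` is zero. -/
theorem gkn_zero (s k n : ℕ) (hs : 2 ≤ s) (hk3 : 3 ≤ k) (hk : k ≤ 2 ^ s)
    (hn : n = 2 ^ s + k) :
    sw k (n - k) ⟨0, by omega⟩ ^ (2 ^ s) * sw k (n - k) ⟨1, by omega⟩ ^ (2 ^ s) *
      sw k (n - k) ⟨2, by omega⟩ ^ (2 ^ s) = 0 := by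
  have hm : n - k = 2 ^ s := by omega
  rw [hm]
  exact gkn_zero_aux s k hk3 hk
end
end

section
/- Let s ≥ 3 and t be integers with 3 ≤ t ≤ 2^{s−1}, and put n = 2^s + 2^{s−1} + t. Then the product w_1^{2^s} · w_2^{2^s} · w_3^{2^{s−1}} · w_4^{t−3} is a nonzero element of A(4,n). -/
open MvPolynomial TensorProduct

noncomputable section

theorem two_eq_zero_alg {S : Type*} [CommRing S] [Algebra (ZMod 2) S] : (2 : S) = 0 := by
  have h : algebraMap (ZMod 2) S 2 = 0 := by
    rw [show (2 : ZMod 2) = 0 from rfl, map_zero]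
  rwa [map_ofNat] at h

theorem coeff_aeval_wt {S σ : Type*} [CommRing S] [Algebra (ZMod 2) S] (wt : σ → ℕ)
    (f : σ → S) (d : ℕ) (p : MvPolynomial σ (ZMod 2)) :
    (aeval (fun v => Polynomial.C (f v) * Polynomial.X ^ wt v) p : Polynomial S).coeff d =
      aeval f (weightedHomogeneousComponent wt d p) := by
  induction p using MvPolynomial.induction_on' with
  | add p q ih1 ih2 => rw [map_add, map_add, map_add, Polynomial.coeff_add, ih1, ih2]
  | monomial a b =>
    have key : (aeval (fun v => Polynomial.C (f v) * Polynomial.X ^ wt v) (monomial a b) :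
        Polynomial S) = Polynomial.C (aeval f (monomial a b)) *
          Polynomial.X ^ (Finsupp.weight wt a) := by
      rw [aeval_monomial, aeval_monomial, Finsupp.weight_apply, Finsupp.prod, Finsupp.prod,
        Finsupp.sum, map_mul, map_prod, ← Finset.prod_pow_eq_pow_sum, mul_assoc,
        ← Finset.prod_mul_distrib]
      congr 1
      refine Finset.prod_congr rfl fun i _ => ?_
      rw [mul_pow, map_pow, ← pow_mul, smul_eq_mul, mul_comm (wt i)]
    rw [key, Polynomial.coeff_C_mul, Polynomial.coeff_X_pow]
    by_cases hd : d = Finsupp.weight wt a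
    · rw [hd, IsWeightedHomogeneous.weightedHomogeneousComponent_same
        (isWeightedHomogeneous_monomial wt a b rfl)]
      simp
    · rw [IsWeightedHomogeneous.weightedHomogeneousComponent_ne _
        (isWeightedHomogeneous_monomial wt a b rfl) hd]
      simp [hd]

theorem hom_exists (m : ℕ) {S : Type*} [CommRing S] [Algebra (ZMod 2) S] (e : Fin 4 → S)
    (G : ℕ → S) (h0 : G 0 = 0) (h1 : G 1 = 0) (h2 : G 2 = 0) (h3 : G 3 = 1)
    (hrec : ∀ j, G (j + 4) = e 0 * G (j + 3) + e 1 * G (j + 2) + e 2 * G (j + 1) + e 3 * G j)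
    (hz : ∀ j, m + 4 ≤ j → G j = 0) :
    ∃ φ : GrassCoh 4 m →+* S, ∀ i, φ (sw 4 m i) = e i := by
  let f : Fin 4 ⊕ Fin m → S := Sum.elim e (fun j => G (j + 4))
  have hf : ∀ a ∈ grassIdeal 4 m, (aeval f : _ →ₐ[ZMod 2] S).toRingHom a = 0 := by
    intro a ha
    have hle : grassIdeal 4 m ≤ RingHom.ker (aeval f : _ →ₐ[ZMod 2] S).toRingHom := by
      rw [grassIdeal, Ideal.span_le]
      rintro p ⟨d, hd, rfl⟩
      change aeval f _ = 0
      rw [← coeff_aeval_wt]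
      set H : Polynomial S := 1 + ∑ j : Fin m, Polynomial.C (G (j + 4)) *
        Polynomial.X ^ ((j : ℕ) + 1) with hH
      have hHc : ∀ j, H.coeff j = G (j + 3) := by
        intro j
        rw [hH, Fin.sum_univ_eq_sum_range
          (fun j => Polynomial.C (G (j + 4)) * Polynomial.X ^ (j + 1)) m]
        rw [Polynomial.coeff_add, Polynomial.finsetSum_coeff]
        simp only [Polynomial.coeff_C_mul, Polynomial.coeff_X_pow, Polynomial.coeff_one]
        rcases j with _ | j
        · simp [h3]
        · simp only [Nat.add_right_cancel_iff, mul_ite, mul_one, mul_zero]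
          rw [Finset.sum_ite_eq]
          by_cases hj : j < m
          · simp [hj]
          · simp [hj, hz (j + 1 + 3) (by omega)]
      have hr : (aeval (fun v => Polynomial.C (f v) * Polynomial.X ^ grassWt 4 m v)
          (grassRel 4 m) : Polynomial S) =
          H + Polynomial.C (e 0) * (Polynomial.X ^ 1 * H)
            + Polynomial.C (e 1) * (Polynomial.X ^ 2 * H)
            + Polynomial.C (e 2) * (Polynomial.X ^ 3 * H)
            + Polynomial.C (e 3) * (Polynomial.X ^ 4 * H) - 1 := by
        simp only [grassRel, map_sub, map_mul, map_add, map_one, map_sum, aeval_X, f, grassWt,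
          Sum.elim_inl, Sum.elim_inr, ← hH, Fin.sum_univ_four]
        simp
        ring
      rw [hr]
      obtain ⟨d, rfl⟩ : ∃ d', d = d' + 1 := ⟨d - 1, by omega⟩
      simp only [Polynomial.coeff_add, Polynomial.coeff_sub, Polynomial.coeff_C_mul,
        Polynomial.coeff_X_pow_mul', hHc, Polynomial.coeff_one]
      have e1 : (if 1 ≤ d + 1 then G (d + 1 - 1 + 3) else 0) = G (d + 3) := by simp
      have e2 : (if 2 ≤ d + 1 then G (d + 1 - 2 + 3) else 0) = G (d + 2) := by
        rcases d with _ | d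
        · simp [h2]
        · exact if_pos (by omega)
      have e3 : (if 3 ≤ d + 1 then G (d + 1 - 3 + 3) else 0) = G (d + 1) := by
        rcases d with _ | _ | d
        · simp [h1]
        · simp [h2]
        · exact if_pos (by omega)
      have e4 : (if 4 ≤ d + 1 then G (d + 1 - 4 + 3) else 0) = G d := by
        rcases d with _ | _ | _ | d
        · simp [h0]
        · simp [h1]
        · simp [h2]
        · exact if_pos (by omega)
      rw [e1, e2, e3, e4, if_neg (by omega), show d + 1 + 3 = d + 4 from rfl]
      have h22 : (2 : S) = 0 := two_eq_zero_alg
      linear_combination (-1 : S) * hrec d + G (d + 4) * h22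
    exact hle ha
  refine ⟨Ideal.Quotient.lift (grassIdeal 4 m) _ hf, fun i => ?_⟩
  rw [sw, Ideal.Quotient.lift_mk]
  change aeval f (X (Sum.inl i)) = e i
  simp [f]

/-- The complete symmetric polynomials in terms of the elementary ones, shifted by 3. -/
def gSeq {S : Type*} [CommRing S] (a b c d : S) : ℕ → S
  | 0 => 0
  | 1 => 0
  | 2 => 0
  | 3 => 1
  | (j + 4) => a * gSeq a b c d (j + 3) + b * gSeq a b c d (j + 2) + c * gSeq a b c d (j + 1)
      + d * gSeq a b c d j

theorem map_gSeq {S T : Type*} [CommRing S] [CommRing T] (φ : S →+* T) (a b c d : S) :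
    ∀ j, φ (gSeq a b c d j) = gSeq (φ a) (φ b) (φ c) (φ d) j
  | 0 => by simp [gSeq]
  | 1 => by simp [gSeq]
  | 2 => by simp [gSeq]
  | 3 => by simp [gSeq]
  | (j + 4) => by
    simp only [gSeq, map_add, map_mul, map_gSeq φ a b c d j, map_gSeq φ a b c d (j + 1),
      map_gSeq φ a b c d (j + 2), map_gSeq φ a b c d (j + 3)]

/-- Vandermonde in three variables mod 2. -/
def vd3 {S : Type*} [CommRing S] (x y z : S) : S := (x + y) * (x + z) * (y + z)

/-- Vandermonde in four variables mod 2. -/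
def vd4 {S : Type*} [CommRing S] (x y z w : S) : S :=
  (x + y) * (x + z) * (x + w) * (y + z) * (y + w) * (z + w)

theorem vd4_mul_gSeq {S : Type*} [CommRing S] (h2 : (2 : S) = 0) (x y z w : S) :
    ∀ j, gSeq (x + y + z + w) (x * y + x * z + x * w + y * z + y * w + z * w)
      (x * y * z + x * y * w + x * z * w + y * z * w) (x * y * z * w) j * vd4 x y z w =
      x ^ j * vd3 y z w + y ^ j * vd3 x z w + z ^ j * vd3 x y w + w ^ j * vd3 x y z
  | 0 => by
    simp only [gSeq, vd4, vd3]
    linear_combination (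
      (-1) * z ^ 1 * w ^ 2 + (-1) * z ^ 2 * w ^ 1 + (-1) * y ^ 1 * w ^ 2 + (-1) * y ^ 1 * z ^ 1
      * w ^ 1 + (-1) * y ^ 1 * z ^ 2 + (-1) * y ^ 2 * w ^ 1 + (-1) * y ^ 2 * z ^ 1 + (-1) * x ^
      1 * w ^ 2 + (-1) * x ^ 1 * z ^ 1 * w ^ 1 + (-1) * x ^ 1 * z ^ 2 + (-1) * x ^ 1 * y ^ 1 *
      w ^ 1 + (-1) * x ^ 1 * y ^ 1 * z ^ 1 + (-1) * x ^ 1 * y ^ 2 + (-1) * x ^ 2 * w ^ 1 + (-1)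
      * x ^ 2 * z ^ 1 + (-1) * x ^ 2 * y ^ 1) * h2
  | 1 => by
    simp only [gSeq, vd4, vd3]
    linear_combination (
      (-1) * y ^ 1 * z ^ 1 * w ^ 2 + (-1) * y ^ 1 * z ^ 2 * w ^ 1 + (-1) * y ^ 2 * z ^ 1 * w ^
      1 + (-1) * x ^ 1 * z ^ 1 * w ^ 2 + (-1) * x ^ 1 * z ^ 2 * w ^ 1 + (-1) * x ^ 1 * y ^ 1 *
      w ^ 2 + (-4) * x ^ 1 * y ^ 1 * z ^ 1 * w ^ 1 + (-1) * x ^ 1 * y ^ 1 * z ^ 2 + (-1) * x ^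
      1 * y ^ 2 * w ^ 1 + (-1) * x ^ 1 * y ^ 2 * z ^ 1 + (-1) * x ^ 2 * z ^ 1 * w ^ 1 + (-1) *
      x ^ 2 * y ^ 1 * w ^ 1 + (-1) * x ^ 2 * y ^ 1 * z ^ 1) * h2
  | 2 => by
    simp only [gSeq, vd4, vd3]
    linear_combination (
      (-1) * y ^ 1 * z ^ 2 * w ^ 2 + (-1) * y ^ 2 * z ^ 1 * w ^ 2 + (-1) * y ^ 2 * z ^ 2 * w ^
      1 + (-1) * x ^ 1 * z ^ 2 * w ^ 2 + (-1) * x ^ 1 * y ^ 1 * z ^ 1 * w ^ 2 + (-1) * x ^ 1 *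
      y ^ 1 * z ^ 2 * w ^ 1 + (-1) * x ^ 1 * y ^ 2 * w ^ 2 + (-1) * x ^ 1 * y ^ 2 * z ^ 1 * w ^
      1 + (-1) * x ^ 1 * y ^ 2 * z ^ 2 + (-1) * x ^ 2 * z ^ 1 * w ^ 2 + (-1) * x ^ 2 * z ^ 2 *
      w ^ 1 + (-1) * x ^ 2 * y ^ 1 * w ^ 2 + (-1) * x ^ 2 * y ^ 1 * z ^ 1 * w ^ 1 + (-1) * x ^
      2 * y ^ 1 * z ^ 2 + (-1) * x ^ 2 * y ^ 2 * w ^ 1 + (-1) * x ^ 2 * y ^ 2 * z ^ 1) * h2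
  | 3 => by
    simp only [gSeq, vd4, vd3]
    linear_combination (
      (1) * y ^ 2 * z ^ 2 * w ^ 2 + (2) * x ^ 1 * y ^ 1 * z ^ 2 * w ^ 2 + (2) * x ^ 1 * y ^ 2 *
      z ^ 1 * w ^ 2 + (2) * x ^ 1 * y ^ 2 * z ^ 2 * w ^ 1 + (1) * x ^ 2 * z ^ 2 * w ^ 2 + (2) *
      x ^ 2 * y ^ 1 * z ^ 1 * w ^ 2 + (2) * x ^ 2 * y ^ 1 * z ^ 2 * w ^ 1 + (1) * x ^ 2 * y ^ 2
      * w ^ 2 + (2) * x ^ 2 * y ^ 2 * z ^ 1 * w ^ 1 + (1) * x ^ 2 * y ^ 2 * z ^ 2) * h2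
  | (j + 4) => by
    have i0 := vd4_mul_gSeq h2 x y z w j
    have i1 := vd4_mul_gSeq h2 x y z w (j + 1)
    have i2 := vd4_mul_gSeq h2 x y z w (j + 2)
    have i3 := vd4_mul_gSeq h2 x y z w (j + 3)
    have root : ∀ u : S, (u + x) * (u + y) * (u + z) * (u + w) = 0 →
      u ^ (j + 4) = (x + y + z + w) * u ^ (j + 3)
        + (x * y + x * z + x * w + y * z + y * w + z * w) * u ^ (j + 2)
        + (x * y * z + x * y * w + x * z * w + y * z * w) * u ^ (j + 1)
        + (x * y * z * w) * u ^ j := by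
      intro u hu
      linear_combination u ^ j * hu - (u ^ j * ((x + y + z + w) * u ^ 3
        + (x * y + x * z + x * w + y * z + y * w + z * w) * u ^ 2
        + (x * y * z + x * y * w + x * z * w + y * z * w) * u
        + (x * y * z * w))) * h2
    have rx := root x (by linear_combination x * (x + y) * (x + z) * (x + w) * h2)
    have ry := root y (by linear_combination y * (y + x) * (y + z) * (y + w) * h2)
    have rz := root z (by linear_combination z * (z + x) * (z + y) * (z + w) * h2)
    have rw' := root w (by linear_combination w * (w + x) * (w + y) * (w + z) * h2)
    rw [gSeq, rx, ry, rz, rw']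
    linear_combination (x + y + z + w) * i3
        + (x * y + x * z + x * w + y * z + y * w + z * w) * i2
        + (x * y * z + x * y * w + x * z * w + y * z * w) * i1
        + (x * y * z * w) * i0

/-- The key computation: the product, times the Vandermonde, times a monomial, is the top
monomial. -/
theorem key_comp {Q : Type*} [CommRing Q] [CharP Q 2] (r u : ℕ) (hr : 4 ≤ 2 ^ r)
    (x y z w : Q)
    (hx : x ^ (3 * 2 ^ r + u + 3) = 0) (hy : y ^ (3 * 2 ^ r + u + 3) = 0)
    (hz : z ^ (3 * 2 ^ r + u + 3) = 0) (hw : w ^ (3 * 2 ^ r + u + 3) = 0) :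
    (x + y + z + w) ^ (2 ^ (r + 1)) *
      (x * y + x * z + x * w + y * z + y * w + z * w) ^ (2 ^ (r + 1)) *
      (x * y * z + x * y * w + x * z * w + y * z * w) ^ (2 ^ r) * (x * y * z * w) ^ u
      * vd4 x y z w * (y * z ^ 2 * w ^ (3 * 2 ^ r - 1)) =
    x ^ (3 * 2 ^ r + u + 2) * y ^ (3 * 2 ^ r + u + 2) * z ^ (3 * 2 ^ r + u + 2)
      * w ^ (3 * 2 ^ r + u + 2) := by
  have h2 : (2 : Q) = 0 := CharTwo.two_eq_zero
  have : Fact (Nat.Prime 2) := ⟨Nat.prime_two⟩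
  have big : ∀ v : Q, v ^ (3 * 2 ^ r + u + 3) = 0 → ∀ k, 3 * 2 ^ r + u + 3 ≤ k → v ^ k = 0 := by
    intro v hv k hk
    obtain ⟨l, rfl⟩ := Nat.exists_eq_add_of_le hk
    rw [pow_add, hv, zero_mul]
  have p1 : 2 ^ (r + 1) = 2 ^ r * 2 := pow_succ 2 r
  simp only [p1, pow_mul, add_pow_char_pow, mul_pow]
  generalize hh : 2 ^ r = h at *
  obtain ⟨Y1, hY1⟩ : ∃ Y, Y = x ^ h := ⟨_, rfl⟩
  obtain ⟨Y2, hY2⟩ : ∃ Y, Y = y ^ h := ⟨_, rfl⟩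
  obtain ⟨Y3, hY3⟩ : ∃ Y, Y = z ^ h := ⟨_, rfl⟩
  obtain ⟨Y4, hY4⟩ : ∃ Y, Y = w ^ h := ⟨_, rfl⟩
  have hc : ∀ a b c d : Q, (a + b + c + d) ^ 2 = a ^ 2 + b ^ 2 + c ^ 2 + d ^ 2 := by
    intro a b c d
    simp only [CharTwo.add_sq]
  have hc6 : ∀ a b c d e f : Q, (a + b + c + d + e + f) ^ 2 =
      a ^ 2 + b ^ 2 + c ^ 2 + d ^ 2 + e ^ 2 + f ^ 2 := by
    intro a b c d e f
    simp only [CharTwo.add_sq]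
  rw [← hY1, ← hY2, ← hY3, ← hY4, hc, hc6]
  -- the last variable
  obtain ⟨Z, hZ⟩ : ∃ Z, Z = w ^ (3 * h + u - 1) := ⟨_, rfl⟩
  have hZw : w ^ u * w ^ (3 * h - 1) = Z := by
    rw [hZ, ← pow_add]; congr 1; omega
  have hZY : Z * Y4 = 0 := by
    rw [hZ, hY4, ← pow_add]; exact big w hw _ (by omega)
  have hZ4 : Z * w ^ 4 = 0 := by
    rw [hZ, ← pow_add]; exact big w hw _ (by omega)
  have hZ3 : Z * w ^ 3 = w ^ (3 * h + u + 2) := by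
    rw [hZ, ← pow_add]; congr 1; omega
  have hX4 : x ^ u * Y1 ^ 4 = 0 := by
    rw [hY1, ← pow_mul, ← pow_add]; exact big x hx _ (by omega)
  have hYY4 : y ^ u * Y2 ^ 4 = 0 := by
    rw [hY2, ← pow_mul, ← pow_add]; exact big y hy _ (by omega)
  have hZZ4 : z ^ u * Y3 ^ 4 = 0 := by
    rw [hY3, ← pow_mul, ← pow_add]; exact big z hz _ (by omega)
  have hX3 : x ^ u * Y1 ^ 3 * x ^ 2 = x ^ (3 * h + u + 2) := by
    rw [hY1, ← pow_mul, ← pow_add, ← pow_add]; congr 1; omega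
  have hX3' : x ^ u * Y1 ^ 3 * x ^ 3 = 0 := by
    rw [hY1, ← pow_mul, ← pow_add, ← pow_add]; exact big x hx _ (by omega)
  have hY3e : y ^ u * Y2 ^ 3 * y ^ 2 = y ^ (3 * h + u + 2) := by
    rw [hY2, ← pow_mul, ← pow_add, ← pow_add]; congr 1; omega
  have hY3' : y ^ u * Y2 ^ 3 * y ^ 3 = 0 := by
    rw [hY2, ← pow_mul, ← pow_add, ← pow_add]; exact big y hy _ (by omega)
  have hZ3e : z ^ u * Y3 ^ 3 * z ^ 2 = z ^ (3 * h + u + 2) := by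
    rw [hY3, ← pow_mul, ← pow_add, ← pow_add]; congr 1; omega
  have hZ3' : z ^ u * Y3 ^ 3 * z ^ 3 = 0 := by
    rw [hY3, ← pow_mul, ← pow_add, ← pow_add]; exact big z hz _ (by omega)
  rw [← hX3, ← hY3e, ← hZ3e, ← hZ3]
  have s1 : Z * (Y1 ^ 2 + Y2 ^ 2 + Y3 ^ 2 + Y4 ^ 2) = Z * (Y1 ^ 2 + Y2 ^ 2 + Y3 ^ 2) := by
    linear_combination Y4 * hZY
  have s2 : Z * ((Y1 * Y2) ^ 2 + (Y1 * Y3) ^ 2 + (Y1 * Y4) ^ 2 + (Y2 * Y3) ^ 2 + (Y2 * Y4) ^ 2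
      + (Y3 * Y4) ^ 2) = Z * ((Y1 * Y2) ^ 2 + (Y1 * Y3) ^ 2 + (Y2 * Y3) ^ 2) := by
    linear_combination Y4 * (Y1 ^ 2 + Y2 ^ 2 + Y3 ^ 2) * hZY
  have s3 : Z * (Y1 * Y2 * Y3 + Y1 * Y2 * Y4 + Y1 * Y3 * Y4 + Y2 * Y3 * Y4) =
      Z * (Y1 * Y2 * Y3) := by
    linear_combination (Y1 * Y2 + Y1 * Y3 + Y2 * Y3) * hZY
  generalize x ^ u = xu at *
  generalize y ^ u = yu at *
  generalize z ^ u = zu at *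
  have s4 : xu * yu * zu * ((Y1 ^ 2 + Y2 ^ 2 + Y3 ^ 2) *
      ((Y1 * Y2) ^ 2 + (Y1 * Y3) ^ 2 + (Y2 * Y3) ^ 2) * (Y1 * Y2 * Y3)) =
      (xu * Y1 ^ 3) * (yu * Y2 ^ 3) * (zu * Y3 ^ 3) := by
    linear_combination (yu * zu * Y1 * Y2 * Y3 * (Y2 ^ 2 + Y3 ^ 2)) * hX4
      + (xu * zu * Y1 * Y2 * Y3 * (Y1 ^ 2 + Y3 ^ 2)) * hYY4
      + (xu * yu * Y1 * Y2 * Y3 * (Y1 ^ 2 + Y2 ^ 2)) * hZZ4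
      + (xu * yu * zu * (Y1 * Y2 * Y3) ^ 3) * h2
  have s5 : Z * ((Y1 ^ 2 + Y2 ^ 2 + Y3 ^ 2 + Y4 ^ 2) *
      ((Y1 * Y2) ^ 2 + (Y1 * Y3) ^ 2 + (Y1 * Y4) ^ 2 + (Y2 * Y3) ^ 2 + (Y2 * Y4) ^ 2
      + (Y3 * Y4) ^ 2) * (Y1 * Y2 * Y3 + Y1 * Y2 * Y4 + Y1 * Y3 * Y4 + Y2 * Y3 * Y4)) =
      Z * ((Y1 ^ 2 + Y2 ^ 2 + Y3 ^ 2) *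
      ((Y1 * Y2) ^ 2 + (Y1 * Y3) ^ 2 + (Y2 * Y3) ^ 2) * (Y1 * Y2 * Y3)) := by
    rw [← mul_assoc, ← mul_assoc, s1, mul_right_comm Z, s2, mul_right_comm, mul_right_comm Z,
      s3]
    ring
  generalize hA : (Y1 ^ 2 + Y2 ^ 2 + Y3 ^ 2 + Y4 ^ 2) *
      ((Y1 * Y2) ^ 2 + (Y1 * Y3) ^ 2 + (Y1 * Y4) ^ 2 + (Y2 * Y3) ^ 2 + (Y2 * Y4) ^ 2
      + (Y3 * Y4) ^ 2) * (Y1 * Y2 * Y3 + Y1 * Y2 * Y4 + Y1 * Y3 * Y4 + Y2 * Y3 * Y4) = A at *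
  generalize hB : (Y1 ^ 2 + Y2 ^ 2 + Y3 ^ 2) *
      ((Y1 * Y2) ^ 2 + (Y1 * Y3) ^ 2 + (Y2 * Y3) ^ 2) * (Y1 * Y2 * Y3) = B at *
  generalize xu * Y1 ^ 3 = a at *
  generalize yu * Y2 ^ 3 = b at *
  generalize zu * Y3 ^ 3 = c at *
  have s6 : A * (xu * yu * zu * w ^ u) * vd4 x y z w * (y * z ^ 2 * w ^ (3 * h - 1)) =
      (a * b * c) * Z * (vd4 x y z w * (y * z ^ 2)) := by
    rw [← s4]
    linear_combination (A * xu * yu * zu * vd4 x y z w * y * z ^ 2) * hZw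
      + (xu * yu * zu * vd4 x y z w * y * z ^ 2) * s5
  rw [s6]
  have s7 : c * z ^ 2 * vd4 x y z w = c * z ^ 2 * ((x + y) * x * (x + w) * y * (y + w) * w) := by
    simp only [vd4]
    linear_combination ((x + y) * (x + w) * (y + w) * (z ^ 2 + z * (x + y + w)
      + (x * y + x * w + y * w))) * hZ3'
  have s8 : b * y * ((x + y) * x * (x + w) * y * (y + w) * w) =
      b * y ^ 2 * (x * x * (x + w) * w * w) := by
    linear_combination (x * (x + w) * w * (y + (x + w))) * hY3'
  have s9 : a * (x * x * (x + w) * w * w) = a * x ^ 2 * w ^ 3 := by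
    linear_combination (w ^ 2) * hX3'
  linear_combination (a * b * Z * y) * s7 + (a * c * Z * z ^ 2) * s8 + (b * c * Z * y ^ 2 * z ^ 2) * s9

theorem g4n_nonzero (s t n : ℕ) (hs : 3 ≤ s) (ht3 : 3 ≤ t) (ht : t ≤ 2 ^ (s - 1))
    (hn : n = 2 ^ s + 2 ^ (s - 1) + t) :
    sw 4 (n - 4) 0 ^ (2 ^ s) * sw 4 (n - 4) 1 ^ (2 ^ s) * sw 4 (n - 4) 2 ^ (2 ^ (s - 1)) *
      sw 4 (n - 4) 3 ^ (t - 3) ≠ 0 := by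
  obtain ⟨r, rfl⟩ : ∃ r, s = r + 1 := ⟨s - 1, by omega⟩
  obtain ⟨u, rfl⟩ : ∃ u, t = u + 3 := ⟨t - 3, by omega⟩
  simp only [Nat.add_sub_cancel] at *
  have hr : 4 ≤ 2 ^ r := by
    calc 4 = 2 ^ 2 := rfl
      _ ≤ 2 ^ r := Nat.pow_le_pow_right (by norm_num) (by omega)
  have hn' : n = 3 * 2 ^ r + u + 3 := by rw [hn, pow_succ]; ring
  let R := MvPolynomial (Fin 4) (ZMod 2)
  let I : Ideal R := Ideal.span ((fun a => monomial a (1 : ZMod 2)) ''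
    (Set.range fun i : Fin 4 => Finsupp.single i n))
  let Q := R ⧸ I
  let x : Fin 4 → Q := fun i => Ideal.Quotient.mk I (X i)
  have hx : ∀ i, x i ^ n = 0 := by
    intro i
    simp only [x]
    rw [← map_pow, Ideal.Quotient.eq_zero_iff_mem, X_pow_eq_monomial]
    exact Ideal.subset_span ⟨_, ⟨i, rfl⟩, rfl⟩
  have htop : x 0 ^ (3 * 2 ^ r + u + 2) * x 1 ^ (3 * 2 ^ r + u + 2) * x 2 ^ (3 * 2 ^ r + u + 2)
      * x 3 ^ (3 * 2 ^ r + u + 2) ≠ 0 := by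
    simp only [x]
    rw [← map_pow, ← map_pow, ← map_pow, ← map_pow, ← map_mul, ← map_mul, ← map_mul, Ne,
      Ideal.Quotient.eq_zero_iff_mem, mem_ideal_span_monomial_image]
    intro hall
    have heq : ∀ k : ℕ, (X 0 ^ k * X 1 ^ k * X 2 ^ k * X 3 ^ k : MvPolynomial (Fin 4) (ZMod 2)) =
        monomial (Finsupp.single 0 k + Finsupp.single 1 k + Finsupp.single 2 k
          + Finsupp.single 3 k) 1 := by
      intro k
      simp only [X_pow_eq_monomial, monomial_mul, mul_one]
    erw [heq] at hall
    obtain ⟨si, ⟨i, rfl⟩, hi⟩ := hall _ (by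
      rw [support_monomial, if_neg one_ne_zero]; exact Finset.mem_singleton_self _)
    have := hi i
    fin_cases i <;> simp at this <;> omega
  have h2 : (2 : Q) = 0 := two_eq_zero_alg
  have h10 : (1 : Q) ≠ 0 := by
    intro h
    apply htop
    rw [← mul_one (_ * _), h, mul_zero]
  have : CharP Q 2 := CharTwo.of_one_ne_zero_of_two_eq_zero h10 h2
  let V : Q := vd4 (x 0) (x 1) (x 2) (x 3)
  let J : Ideal Q := Submodule.annihilator (Ideal.span {V})
  have hJ : ∀ a : Q, Ideal.Quotient.mk J a = 0 ↔ a * V = 0 := by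
    intro a
    rw [Ideal.Quotient.eq_zero_iff_mem]
    exact Submodule.mem_annihilator_span_singleton V a
  let e1 := x 0 + x 1 + x 2 + x 3
  let e2 := x 0 * x 1 + x 0 * x 2 + x 0 * x 3 + x 1 * x 2 + x 1 * x 3 + x 2 * x 3
  let e3 := x 0 * x 1 * x 2 + x 0 * x 1 * x 3 + x 0 * x 2 * x 3 + x 1 * x 2 * x 3
  let e4 := x 0 * x 1 * x 2 * x 3
  let π := Ideal.Quotient.mk J
  obtain ⟨φ, hφ⟩ := hom_exists (n - 4) (S := Q ⧸ J) ![π e1, π e2, π e3, π e4]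
    (fun j => π (gSeq e1 e2 e3 e4 j)) (by simp [gSeq]) (by simp [gSeq]) (by simp [gSeq])
    (by simp [gSeq]) (by intro j; simp [gSeq]) (by
      intro j hj
      rw [hJ, vd4_mul_gSeq h2]
      obtain ⟨l, rfl⟩ : ∃ l, j = n + l := ⟨j - n, by omega⟩
      simp [pow_add, hx])
  intro hzero
  apply htop
  have hz := congrArg φ hzero
  simp only [map_mul, map_pow, hφ, map_zero] at hz
  have hz' : π (e1 ^ (2 ^ (r + 1)) * e2 ^ (2 ^ (r + 1)) * e3 ^ (2 ^ r) * e4 ^ u) = 0 := by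
    simpa using hz
  rw [hJ] at hz'
  rw [← key_comp r u hr (x 0) (x 1) (x 2) (x 3) (hn' ▸ hx 0) (hn' ▸ hx 1) (hn' ▸ hx 2)
    (hn' ▸ hx 3)]
  have := congrArg (· * (x 1 * x 2 ^ 2 * x 3 ^ (3 * 2 ^ r - 1))) hz'
  simpa only [zero_mul] using this
end
end

section
/- Let A be a commutative ℕ-graded algebra over the field ℤ/2, and let w ∈ A be a homogeneous element of positive degree whose height is n ≥ 1, i.e. w^n ≠ 0 and w^{n+1} = 0. Then in the tensor product algebra A ⊗_{ℤ/2} A the element z(w) := w⊗1 + 1⊗w has height exactly ρ(n) − 1; that is, z(w)^{ρ(n)−1} ≠ 0 and z(w)^{ρ(n)} = 0. -/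
open TensorProduct

noncomputable section

/-- `ρ m` : the smallest integral power of `2` that is strictly greater than `m`. -/
def rho (m : ℕ) : ℕ := 2 ^ m.size

/-- All binomial coefficients `C(2^s - 1, k)` with `k < 2^s` are odd. -/
theorem choose_two_pow_sub_one_odd (s k : ℕ) (hk : k < 2 ^ s) :
    (((2 ^ s - 1).choose k : ℕ) : ZMod 2) = 1 := by
  induction k with
  | zero => simp
  | succ k ih =>
    have h1 := ih (by omega)
    have h2 : 2 ∣ (2 ^ s).choose (k + 1) :=
      Nat.prime_two.dvd_choose_pow (by omega) (by omega)
    have h3 : (2 ^ s).choose (k + 1) = (2 ^ s - 1).choose k + (2 ^ s - 1).choose (k + 1) := by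
      obtain ⟨m, hm⟩ : ∃ m, 2 ^ s = m + 1 := ⟨2 ^ s - 1, by omega⟩
      rw [hm, Nat.choose_succ_succ]; simp
    have h4 : (((2 ^ s).choose (k + 1) : ℕ) : ZMod 2) = 0 :=
      (ZMod.natCast_eq_zero_iff _ _).2 h2
    rw [h3, Nat.cast_add, h1] at h4
    generalize (((2 ^ s - 1).choose (k + 1) : ℕ) : ZMod 2) = x at h4 ⊢
    revert x; decide

/-- Let `A` be a commutative ℕ-graded algebra over `ℤ/2` and `w` a homogeneous element of
positive degree with `w^n ≠ 0` and `w^{n+1} = 0` (`n ≥ 1`).  Then in `A ⊗[ℤ/2] A` the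
element `z(w) = w ⊗ 1 + 1 ⊗ w` has height exactly `ρ(n) - 1`. -/
theorem height_zero_divisor (A : Type*) [CommRing A] [Algebra (ZMod 2) A]
    (𝒜 : ℕ → Submodule (ZMod 2) A) [GradedAlgebra 𝒜]
    (w : A) (d : ℕ) (hd : 0 < d) (hw : w ∈ 𝒜 d)
    (n : ℕ) (hn : 1 ≤ n) (hpow : w ^ n ≠ 0) (hpow1 : w ^ (n + 1) = 0) :
    (w ⊗ₜ[ZMod 2] (1 : A) + (1 : A) ⊗ₜ[ZMod 2] w) ^ (rho n - 1) ≠ 0 ∧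
    (w ⊗ₜ[ZMod 2] (1 : A) + (1 : A) ⊗ₜ[ZMod 2] w) ^ (rho n) = 0 := by
  have hlt : n < 2 ^ n.size := Nat.lt_size_self n
  have hle : 2 ^ n.size ≤ 2 * n := by
    have h1 : 0 < n.size := Nat.size_pos.2 hn
    have h2 : 2 ^ (n.size - 1) ≤ n := Nat.lt_size.1 (by omega)
    have h3 : 2 ^ n.size = 2 * 2 ^ (n.size - 1) := by
      rw [← pow_succ']; congr 1; omega
    omega
  have hz : ∀ m, n < m → w ^ m = 0 := fun m hm => pow_eq_zero_of_le hm hpow1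
  unfold rho
  constructor
  · intro h0
    obtain ⟨φ, hφ⟩ : ∃ φ : Module.Dual (ZMod 2) A, φ (w ^ n) ≠ 0 := by
      by_contra! hc
      exact hpow ((Module.forall_dual_apply_eq_zero_iff (ZMod 2) _).1 hc)
    let f : A →ₗ[ZMod 2] ZMod 2 := φ ∘ₗ GradedAlgebra.proj 𝒜 (n * d)
    have hmem : ∀ i, w ^ i ∈ 𝒜 (i * d) := fun i => by
      simpa using SetLike.pow_mem_graded i hw
    have hfn : f (w ^ n) ≠ 0 := by
      simpa [f, GradedAlgebra.proj_apply, DirectSum.decompose_of_mem_same 𝒜 (hmem n)] using hφ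
    have hfi : ∀ i, i ≠ n → f (w ^ i) = 0 := fun i hi => by
      have hne : i * d ≠ n * d := fun h => hi (Nat.eq_of_mul_eq_mul_right hd h)
      simp [f, GradedAlgebra.proj_apply, DirectSum.decompose_of_mem_ne 𝒜 (hmem i) hne]
    let F : A ⊗[ZMod 2] A →ₗ[ZMod 2] A :=
      (TensorProduct.lid (ZMod 2) A).toLinearMap ∘ₗ LinearMap.rTensor A f
    have hF : ∀ a b, F (a ⊗ₜ b) = f a • b := fun a b => by simp [F]
    have h1 := congrArg F h0
    rw [add_pow, map_sum, map_zero, Finset.sum_eq_single n] at h1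
    · rw [← nsmul_eq_mul', ← Nat.cast_smul_eq_nsmul (ZMod 2),
        choose_two_pow_sub_one_odd _ _ hlt, one_smul, Algebra.TensorProduct.tmul_pow,
        Algebra.TensorProduct.tmul_pow, Algebra.TensorProduct.tmul_mul_tmul, one_pow, one_pow,
        mul_one, one_mul, hF, smul_eq_zero] at h1
      rcases h1 with h1 | h1
      · exact hfn h1
      · exact hpow (pow_eq_zero_of_le (by omega) h1)
    · intro i _ hi
      rw [← nsmul_eq_mul', map_nsmul, Algebra.TensorProduct.tmul_pow,
        Algebra.TensorProduct.tmul_pow, Algebra.TensorProduct.tmul_mul_tmul, one_pow, one_pow,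
        mul_one, one_mul, hF, hfi i hi, zero_smul, smul_zero]
    · intro h
      exact absurd (Finset.mem_range.2 (by omega)) h
  · have : Nontrivial A := ⟨⟨_, _, hpow⟩⟩
    have : Nontrivial (A ⊗[ZMod 2] A) := inferInstance
    have : CharP (A ⊗[ZMod 2] A) 2 := charP_of_injective_algebraMap' (ZMod 2) 2
    rw [add_pow_char_pow, Algebra.TensorProduct.tmul_pow, Algebra.TensorProduct.tmul_pow,
      hz _ hlt, TensorProduct.zero_tmul, TensorProduct.tmul_zero, add_zero]
end
end
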